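/- Let X be a geodesically complete, negatively curved Hadamard space, and assume X is either (1) a metric tree, or (2) a Riemannian manifold, or more generally (3) a space having a dense subset all of whose points admit a neighborhood isometric to an open subset of a Riemannian manifold of dimension at least 2. Then W₂(X) is isometrically rigid: every isometry of W₂(X) is the push-forward φ_# of an isometry φ of X, i.e. the natural morphism Isom(X) → Isom(W₂(X)) is an isomorphism. -/

import Mathlib

open MeasureTheory Filter Set Topology
open scoped NNReal ENNReal

noncomputable section


/-! ## Geodesics and Hadamard spaces -/

/-- `γ` is a geodesic on the set of parameters `s`, of speed `v`, with respect to the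
distance function `d`. -/
def IsGeodesicOnWith {A : Type*} (d : A → A → ℝ) (γ : ℝ → A) (s : Set ℝ) (v : ℝ) : Prop :=
  ∀ t ∈ s, ∀ t' ∈ s, d (γ t) (γ t') = v * |t - t'|

/-- A metric space is geodesic if any two points are joined by a geodesic. -/
def IsGeodesicSpace (Y : Type*) [MetricSpace Y] : Prop :=
  ∀ x y : Y, ∃ γ : ℝ → Y, γ 0 = x ∧ γ 1 = y ∧
    IsGeodesicOnWith dist γ (Set.Icc (0:ℝ) 1) (dist x y)

/-- Every geodesic segment extends to a complete geodesic (defined on all of `ℝ`). -/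
def GeodesicallyComplete (Y : Type*) [MetricSpace Y] : Prop :=
  ∀ (γ : ℝ → Y) (a b v : ℝ), a < b → IsGeodesicOnWith dist γ (Set.Icc a b) v →
    ∃ g : ℝ → Y, IsGeodesicOnWith dist g Set.univ v ∧ ∀ t ∈ Set.Icc a b, g t = γ t

/-- A Hadamard space: complete, separable, locally compact, geodesic, globally CAT(0).
The CAT(0) comparison inequality is expressed through the explicit formula for the distance
from a vertex to a point of the opposite side in the Euclidean comparison triangle. -/
structure IsHadamard (X : Type*) [MetricSpace X] : Prop where
  complete : CompleteSpace X
  separable : TopologicalSpace.SeparableSpace X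
  locallyCompact : LocallyCompactSpace X
  geodesic : IsGeodesicSpace X
  cat0 : ∀ (x y z : X) (γ : ℝ → X), γ 0 = y → γ 1 = z →
    IsGeodesicOnWith dist γ (Set.Icc (0:ℝ) 1) (dist y z) →
    ∀ t ∈ Set.Icc (0:ℝ) 1,
      dist x (γ t) ^ 2 ≤ (1 - t) * dist x y ^ 2 + t * dist x z ^ 2 - t * (1 - t) * dist y z ^ 2

/-- A space is non-branching if two geodesics coinciding on a nonempty open set of parameters
coincide on their whole common interval of definition. -/
def NonBranching (X : Type*) [MetricSpace X] : Prop :=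
  ∀ (γ β : ℝ → X) (I : Set ℝ) (v w : ℝ),
    IsGeodesicOnWith dist γ I v → IsGeodesicOnWith dist β I w →
    (∃ U : Set ℝ, U ⊆ I ∧ IsOpen U ∧ U.Nonempty ∧ ∀ t ∈ U, γ t = β t) →
    ∀ t ∈ I, γ t = β t

/-! ## The Wasserstein space -/

/-- `π` is a coupling (transport plan) between `μ` and `ν`. -/
def IsCoupling {A B : Type*} [MeasurableSpace A] [MeasurableSpace B]
    (π : Measure (A × B)) (μ : Measure A) (ν : Measure B) : Prop :=
  π.map Prod.fst = μ ∧ π.map Prod.snd = ν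

/-- The quadratic Wasserstein space over `Y`: Borel probability measures with finite second
moment. -/
abbrev W2Space (Y : Type*) [MetricSpace Y] [MeasurableSpace Y] : Type _ :=
  {μ : Measure Y // IsProbabilityMeasure μ ∧
    ∃ x₀ : Y, (∫⁻ x, ENNReal.ofReal (dist x₀ x) ^ 2 ∂μ) < ⊤}

/-- The quadratic transport cost between two measures. -/
def W2cost {Y : Type*} [MetricSpace Y] [MeasurableSpace Y] (μ ν : Measure Y) : ℝ≥0∞ :=
  ⨅ (π : Measure (Y × Y)) (_ : IsCoupling π μ ν),
    ∫⁻ p, ENNReal.ofReal (dist p.1 p.2) ^ 2 ∂π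

/-- The quadratic Wasserstein distance. -/
def Wdist {Y : Type*} [MetricSpace Y] [MeasurableSpace Y] (μ ν : W2Space Y) : ℝ :=
  Real.sqrt (W2cost μ.1 ν.1).toReal


/-! ## Rays, complete geodesics, the boundary at infinity and the cone over it -/

/-- Geodesic rays of `X` (arbitrary nonnegative speed), parametrized by `ℝ≥0`.
The topology (of a subtype of a product) coincides on this set with the topology of
uniform convergence on compact sets. -/
abbrev RaySpace (X : Type*) [MetricSpace X] : Type _ :=
  {γ : ℝ≥0 → X // ∃ v : ℝ, 0 ≤ v ∧ ∀ s t : ℝ≥0, dist (γ s) (γ t) = v * dist s t}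

/-- Unit speed geodesic rays of `X`. -/
abbrev UnitRay (X : Type*) [MetricSpace X] : Type _ :=
  {γ : ℝ≥0 → X // ∀ s t : ℝ≥0, dist (γ s) (γ t) = dist s t}

/-- Complete geodesics of `X` (arbitrary nonnegative speed). -/
abbrev GeoLine (X : Type*) [MetricSpace X] : Type _ :=
  {γ : ℝ → X // ∃ v : ℝ, 0 ≤ v ∧ ∀ s t : ℝ, dist (γ s) (γ t) = v * |s - t|}

/-- Complete unit speed geodesics of `X`. -/
abbrev UnitLine (X : Type*) [MetricSpace X] : Type _ :=
  {γ : ℝ → X // ∀ s t : ℝ, dist (γ s) (γ t) = |s - t|}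

/-- Evaluation of a ray at time `t`. -/
def rayEval {X : Type*} [MetricSpace X] (t : ℝ≥0) : RaySpace X → X := fun γ => γ.1 t

/-- Two curves (w.r.t. a distance function `d`) are asymptotic if they stay at bounded
distance. -/
def AsymptoticMaps {A : Type*} (d : A → A → ℝ) (γ β : ℝ≥0 → A) : Prop :=
  ∃ C : ℝ, ∀ t, d (γ t) (β t) ≤ C

/-- The asymptote relation on unit-speed rays. -/
def unitRaySetoid (X : Type*) [MetricSpace X] : Setoid (UnitRay X) where
  r γ β := AsymptoticMaps dist γ.1 β.1
  iseqv := by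
    refine ⟨fun γ => ⟨0, fun t => by simp⟩, ?_, ?_⟩
    · rintro γ β ⟨C, h⟩
      exact ⟨C, fun t => by rw [dist_comm]; exact h t⟩
    · rintro γ β δ ⟨C, h⟩ ⟨C', h'⟩
      exact ⟨C + C', fun t => (dist_triangle _ _ _).trans (add_le_add (h t) (h' t))⟩

/-- The geodesic boundary of `X`: asymptote classes of unit-speed rays, with the quotient
topology of the topology of uniform convergence on compact sets (the cone topology). -/
abbrev Boundary (X : Type*) [MetricSpace X] := Quotient (unitRaySetoid X)

/-- Apex-like points, to be collapsed when forming the cone over `B`. -/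
def coneIsApex {B : Type*} : B × ℝ≥0 ⊕ Unit → Prop
  | Sum.inl p => p.2 = 0
  | Sum.inr _ => True

/-- The relation collapsing all apex-like points. -/
def coneSetoid (B : Type*) : Setoid (B × ℝ≥0 ⊕ Unit) where
  r p q := p = q ∨ (coneIsApex p ∧ coneIsApex q)
  iseqv := by
    refine ⟨fun p => Or.inl rfl, ?_, ?_⟩
    · rintro p q (rfl | h)
      · exact Or.inl rfl
      · exact Or.inr ⟨h.2, h.1⟩
    · rintro p q r (rfl | h) (rfl | h')
      · exact Or.inl rfl
      · exact Or.inr h'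
      · exact Or.inr h
      · exact Or.inr ⟨h.1, h'.2⟩

/-- The cone over a space `B`: the quotient of `B × [0,∞)` collapsing the zero level to the
apex, with the quotient topology. -/
abbrev Cone (B : Type*) := Quotient (coneSetoid B)

/-- The point of the cone over `b` at height (speed) `s`. -/
def coneMk {B : Type*} (b : B) (s : ℝ≥0) : Cone B :=
  Quotient.mk (coneSetoid B) (Sum.inl (b, s))

/-- The apex of the cone. -/
def conePt (B : Type*) : Cone B := Quotient.mk (coneSetoid B) (Sum.inr ())

private def coneSpeedAux {B : Type*} : B × ℝ≥0 ⊕ Unit → ℝ≥0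
  | Sum.inl p => p.2
  | Sum.inr _ => 0

/-- The speed (radial) coordinate of a point of the cone. -/
def coneSpeed {B : Type*} : Cone B → ℝ≥0 :=
  Quotient.lift coneSpeedAux (by
    rintro p q (rfl | ⟨h1, h2⟩)
    · rfl
    · cases p <;> cases q <;> simp_all [coneIsApex, coneSpeedAux])

/-- The speed of a geodesic ray. -/
def raySpeed {X : Type*} [MetricSpace X] (γ : RaySpace X) : ℝ≥0 :=
  nndist (γ.1 0) (γ.1 1)

lemma raySpeed_eq {X : Type*} [MetricSpace X] (γ : RaySpace X) {v : ℝ} (hv0 : 0 ≤ v)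
    (hv : ∀ s t : ℝ≥0, dist (γ.1 s) (γ.1 t) = v * dist s t) : (raySpeed γ : ℝ) = v := by
  have h1 := hv 0 1
  have h2 : dist (0 : ℝ≥0) (1 : ℝ≥0) = 1 := by rw [NNReal.dist_eq]; norm_num
  rw [h2, mul_one] at h1
  rw [show (raySpeed γ : ℝ) = dist (γ.1 0) (γ.1 1) from (dist_nndist _ _).symm, h1]

/-- The unit reparametrization of a nonconstant ray. -/
def rayUnit {X : Type*} [MetricSpace X] (γ : RaySpace X) (h : raySpeed γ ≠ 0) : UnitRay X := by
  refine ⟨fun t => γ.1 (t / raySpeed γ), ?_⟩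
  obtain ⟨v, hv0, hv⟩ := γ.2
  have hveq : (raySpeed γ : ℝ) = v := raySpeed_eq γ hv0 hv
  intro s t
  have hr : (raySpeed γ : ℝ) ≠ 0 := by
    simpa using h
  show dist (γ.1 (s / raySpeed γ)) (γ.1 (t / raySpeed γ)) = dist s t
  rw [hv, NNReal.dist_eq, NNReal.dist_eq, NNReal.coe_div, NNReal.coe_div,
    div_sub_div_same, abs_div, abs_of_nonneg (raySpeed γ).coe_nonneg, ← hveq]
  field_simp

/-- The point at infinity (in the cone over the boundary) defined by a geodesic ray:
its asymptote class together with its speed; constant rays are sent to the apex. -/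
def rayEnd {X : Type*} [MetricSpace X] (γ : RaySpace X) : Cone (Boundary X) :=
  if h : raySpeed γ = 0 then conePt (Boundary X)
  else coneMk (Quotient.mk (unitRaySetoid X) (rayUnit γ h)) (raySpeed γ)

/-! ## Asymptotic distance -/

def dInfty {X : Type*} [MetricSpace X] (γ β : ℝ≥0 → X) : ℝ :=
  Filter.limsup (fun t : ℝ≥0 => dist (γ t) (β t) / (t : ℝ)) Filter.atTop

/-- The asymptotic (angular) distance on the boundary, computed on representative rays
(it does not depend on the choice of representatives). -/
def boundaryDist {X : Type*} [MetricSpace X] (ξ ζ : Boundary X) : ℝ :=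
  dInfty (ξ.out).1 (ζ.out).1

def coneDistAux {X : Type*} [MetricSpace X] :
    Boundary X × ℝ≥0 ⊕ Unit → Boundary X × ℝ≥0 ⊕ Unit → ℝ
  | Sum.inl p, Sum.inl q =>
      Real.sqrt (((p.2 : ℝ) - (q.2 : ℝ)) ^ 2 + (p.2 : ℝ) * (q.2 : ℝ) * boundaryDist p.1 q.1 ^ 2)
  | Sum.inl p, Sum.inr _ => p.2
  | Sum.inr _, Sum.inl q => q.2
  | Sum.inr _, Sum.inr _ => 0

/-- The asymptotic distance on the cone over the boundary (the cone metric). -/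
def coneDist {X : Type*} [MetricSpace X] : Cone (Boundary X) → Cone (Boundary X) → ℝ :=
  Quotient.lift₂ coneDistAux (by
    rintro a₁ a₂ b₁ b₂ h12 h34
    rcases h12 with rfl | ⟨h1, h2⟩ <;> rcases h34 with rfl | ⟨h3, h4⟩
    · rfl
    · rcases a₁ with p | u <;> rcases a₂ with q | v <;> rcases b₂ with q' | w <;>
        simp_all [coneIsApex, coneDistAux, Real.sqrt_sq, NNReal.coe_nonneg]
    · rcases a₂ with q | u <;> rcases a₁ with p | v <;> rcases b₁ with p' | w <;>
        simp_all [coneIsApex, coneDistAux, Real.sqrt_sq, NNReal.coe_nonneg]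
    · rcases a₁ with p | u <;> rcases a₂ with q | v <;> rcases b₁ with p' | w <;>
        rcases b₂ with q' | w' <;>
        simp_all [coneIsApex, coneDistAux, Real.sqrt_sq, NNReal.coe_nonneg])


-- Borel measurable structure on the boundary and the cone over it.
instance (X : Type*) [MetricSpace X] : MeasurableSpace (Boundary X) := borel _
instance (X : Type*) [MetricSpace X] : BorelSpace (Boundary X) := ⟨rfl⟩
instance (X : Type*) [MetricSpace X] : MeasurableSpace (Cone (Boundary X)) := borel _
instance (X : Type*) [MetricSpace X] : BorelSpace (Cone (Boundary X)) := ⟨rfl⟩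

/-- The Wasserstein metric `W_∞` on measures on the cone over the boundary, built from the
cost `d_∞²`. -/
def Winfty {X : Type*} [MetricSpace X] (m m' : Measure (Cone (Boundary X))) : ℝ :=
  Real.sqrt (⨅ (π : Measure (Cone (Boundary X) × Cone (Boundary X)))
    (_ : IsCoupling π m m'),
      ∫⁻ p, ENNReal.ofReal (coneDist p.1 p.2) ^ 2 ∂π).toReal


/-! ## Visibility -/

/-- `X` is a visibility space: any two distinct boundary points are the two endpoints of a
complete geodesic. -/
def IsVisibility (X : Type*) [MetricSpace X] : Prop :=
  ∀ α ω : UnitRay X, ¬ AsymptoticMaps dist α.1 ω.1 →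
    ∃ g : ℝ → X, (∀ s t : ℝ, dist (g s) (g t) = |s - t|) ∧
      AsymptoticMaps dist (fun t : ℝ≥0 => g (-(t : ℝ))) α.1 ∧
      AsymptoticMaps dist (fun t : ℝ≥0 => g (t : ℝ)) ω.1

/-! ## Curves, length, rectifiability -/

/-- The length of a curve with respect to a distance function `d`, as a supremum over
finite monotone sequences of parameters in `[a,b]`. -/
def curveLengthWith {A : Type*} (d : A → A → ℝ) (c : ℝ → A) (a b : ℝ) : ℝ≥0∞ :=
  ⨆ (n : ℕ) (t : Fin (n + 1) → ℝ) (_ : Monotone t) (_ : ∀ i, t i ∈ Set.Icc a b),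
    ∑ i : Fin n, ENNReal.ofReal (d (c (t i.castSucc)) (c (t i.succ)))

/-- Continuity of a curve with respect to a distance function `d`, on a set of parameters. -/
def ContinuousWithRespect {A : Type*} (d : A → A → ℝ) (c : ℝ → A) (s : Set ℝ) : Prop :=
  ∀ t ∈ s, ∀ ε : ℝ, 0 < ε → ∃ δ : ℝ, 0 < δ ∧ ∀ u ∈ s, |u - t| < δ → d (c u) (c t) < ε

/-- `W_∞` between measures on the boundary, viewed as the level `{speed = 1}` of the cone,
with cost `d_∞²`. -/
def WinftyLevel1 {X : Type*} [MetricSpace X] (m m' : Measure (Boundary X)) : ℝ :=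
  Real.sqrt (⨅ (π : Measure (Boundary X × Boundary X)) (_ : IsCoupling π m m'),
    ∫⁻ p, ENNReal.ofReal (coneDist (coneMk p.1 1) (coneMk p.2 1)) ^ 2 ∂π).toReal

/-! ## Support of a measure -/

/-- The (topological) support of a measure. -/
def msupport {A : Type*} [TopologicalSpace A] [MeasurableSpace A] (μ : Measure A) : Set A :=
  {x | ∀ U : Set A, x ∈ U → IsOpen U → 0 < μ U}

/-! ## Cyclical monotonicity and antagonism -/

/-- A set `Γ` is `c`-cyclically monotone if no cyclic permutation of the target points of a
finite family of pairs of `Γ` decreases the total cost. -/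
def CyclicallyMonotone {A : Type*} (c : A → A → ℝ) (Γ : Set (A × A)) : Prop :=
  ∀ (m : ℕ) (p : Fin (m + 1) → A × A), (∀ i, p i ∈ Γ) →
    (∑ i, c (p i).1 (p i).2) ≤ ∑ i, c (p i).1 (p (i + 1)).2

/-- Two curves are antagonist if they pass through two distinct points in opposite orders. -/
def Antagonist {X : Type*} (γ β : ℝ → X) : Prop :=
  ∃ x y : X, x ≠ y ∧ (∃ s t : ℝ, s < t ∧ γ s = x ∧ γ t = y) ∧
    (∃ s t : ℝ, s < t ∧ β s = y ∧ β t = x)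

/-! ## Negative curvature, trees -/

/-- Three points lying on a common geodesic. -/
def Aligned {X : Type*} [MetricSpace X] (x y z : X) : Prop :=
  dist x y + dist y z = dist x z ∨ dist y x + dist x z = dist y z ∨
    dist x z + dist z y = dist x y

/-- `X` is negatively curved: it is not a line, and the CAT(0) comparison inequality is
strict except for aligned triangles. -/
def IsNegativelyCurved (X : Type*) [MetricSpace X] : Prop :=
  (¬ ∃ f : ℝ → X, Function.Surjective f ∧ ∀ s t : ℝ, dist (f s) (f t) = |s - t|) ∧
  ∀ (x y z : X) (γ : ℝ → X), γ 0 = y → γ 1 = z →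
    IsGeodesicOnWith dist γ (Set.Icc (0:ℝ) 1) (dist y z) → ¬ Aligned x y z →
    ∀ t ∈ Set.Ioo (0:ℝ) 1,
      dist x (γ t) ^ 2 < (1 - t) * dist x y ^ 2 + t * dist x z ^ 2 - t * (1 - t) * dist y z ^ 2

/-- A metric tree (real tree): a geodesic space satisfying the four-point 0-hyperbolicity
condition. -/
def IsRealTree (X : Type*) [MetricSpace X] : Prop :=
  IsGeodesicSpace X ∧ ∀ x y z w : X,
    dist x y + dist z w ≤ max (dist x z + dist y w) (dist x w + dist y z)

/-! ## Ends of complete geodesics -/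

/-- The forward ray of a complete geodesic. -/
def lineForward {X : Type*} [MetricSpace X] (γ : GeoLine X) : RaySpace X :=
  ⟨fun t : ℝ≥0 => γ.1 (t : ℝ), by
    obtain ⟨v, hv0, hv⟩ := γ.2
    exact ⟨v, hv0, fun s t => by rw [hv, NNReal.dist_eq]⟩⟩

/-- The backward ray of a complete geodesic. -/
def lineBackward {X : Type*} [MetricSpace X] (γ : GeoLine X) : RaySpace X :=
  ⟨fun t : ℝ≥0 => γ.1 (-(t : ℝ)), by
    obtain ⟨v, hv0, hv⟩ := γ.2
    refine ⟨v, hv0, fun s t => ?_⟩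
    rw [hv, NNReal.dist_eq]
    congr 1
    rw [abs_sub_comm]
    congr 1
    ring⟩

/-- The end at `+∞` of a complete geodesic, in the cone over the boundary. -/
def lineEndPlus {X : Type*} [MetricSpace X] (γ : GeoLine X) : Cone (Boundary X) :=
  rayEnd (lineForward γ)

/-- The end at `-∞` of a complete geodesic, in the cone over the boundary. -/
def lineEndMinus {X : Type*} [MetricSpace X] (γ : GeoLine X) : Cone (Boundary X) :=
  rayEnd (lineBackward γ)

/-- `g` is a unit complete geodesic with ends `ξ` (at `-∞`) and `ζ` (at `+∞`). -/
def LineConnects {X : Type*} [MetricSpace X] (g : ℝ → X) (ξ ζ : Boundary X) : Prop :=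
  (∀ s t : ℝ, dist (g s) (g t) = |s - t|) ∧
  (∃ γ : UnitRay X, Quotient.mk (unitRaySetoid X) γ = ξ ∧
    AsymptoticMaps dist (fun u : ℝ≥0 => g (-(u : ℝ))) γ.1) ∧
  (∃ γ : UnitRay X, Quotient.mk (unitRaySetoid X) γ = ζ ∧
    AsymptoticMaps dist (fun u : ℝ≥0 => g (u : ℝ)) γ.1)

/-- Two boundary points are antipodal if they are joined by a complete geodesic. -/
def Antipodal {X : Type*} [MetricSpace X] (ξ ζ : Boundary X) : Prop :=
  ∃ g : ℝ → X, LineConnects g ξ ζ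

/-- Two measures on the boundary are antipodal if they are concentrated on antipodal sets. -/
def AntipodalMeasures {X : Type*} [MetricSpace X] (νm νp : Measure (Boundary X)) : Prop :=
  ∃ A B : Set (Boundary X), MeasurableSet A ∧ MeasurableSet B ∧ νm A = 1 ∧ νp B = 1 ∧
    ∀ ξ ∈ A, ∀ ζ ∈ B, Antipodal ξ ζ

/-- Two measures on the boundary are uniformly antipodal if their supports are antipodal. -/
def UniformlyAntipodal {X : Type*} [MetricSpace X] (νm νp : Measure (Boundary X)) : Prop :=
  ∀ ξ ∈ msupport νm, ∀ ζ ∈ msupport νp, Antipodal ξ ζ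

/-- The distance from the base point `x₀` to the geodesic line joining two boundary points
(for trees, the Gromov product). -/
def D0 {X : Type*} [MetricSpace X] (x₀ : X) (ξ ζ : Boundary X) : ℝ :=
  sInf {r : ℝ | ∃ g : ℝ → X, LineConnects g ξ ζ ∧ ∃ t : ℝ, r = dist x₀ (g t)}

/-- The unit geodesic from `ξ` to `ζ`, parametrized so that its time-`0` point is closest to
the base point `x₀`. -/
def lineFrom {X : Type*} [MetricSpace X] (x₀ : X) (ξ ζ : Boundary X) : ℝ → X :=
  haveI : Nonempty X := ⟨x₀⟩
  Classical.epsilon fun g : ℝ → X =>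
    LineConnects g ξ ζ ∧ dist x₀ (g 0) = D0 x₀ ξ ζ

/-! ## Flows on trees -/

/-- The set of boundary points whose rays eventually lie in `C`. -/
def compBdry {X : Type*} [MetricSpace X] (C : Set X) : Set (Boundary X) :=
  {ξ | ∀ γ : UnitRay X, Quotient.mk (unitRaySetoid X) γ = ξ →
    ∃ T : ℝ≥0, ∀ t : ℝ≥0, T ≤ t → γ.1 t ∈ C}

/-- The connected components of the complement of a point. -/
def treeComps {X : Type*} [TopologicalSpace X] (x : X) : Set (Set X) :=
  {C | ∃ y : X, y ≠ x ∧ C = connectedComponentIn {x}ᶜ y}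

/-- A vertex (branch point) of a tree: the complement has at least three components. -/
def IsTreeVertex {X : Type*} [TopologicalSpace X] (x : X) : Prop :=
  ∃ C₁ C₂ C₃ : Set X, C₁ ∈ treeComps x ∧ C₂ ∈ treeComps x ∧ C₃ ∈ treeComps x ∧
    C₁ ≠ C₂ ∧ C₂ ≠ C₃ ∧ C₁ ≠ C₃

/-- The value of the signed measure `ν₊ - ν₋` on a set of boundary points. -/
def sflow {X : Type*} [MetricSpace X] (νm νp : Measure (Boundary X))
    (S : Set (Boundary X)) : ℝ :=
  (νp S).toReal - (νm S).toReal

/-- The boundary directions at `x` carrying positive flow. -/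
def posBdrySet {X : Type*} [MetricSpace X] (νm νp : Measure (Boundary X)) (x : X) :
    Set (Boundary X) :=
  ⋃ (C : Set X) (_ : C ∈ treeComps x) (_ : 0 < sflow νm νp (compBdry C)), compBdry C

/-- The boundary directions at `x` carrying negative flow. -/
def negBdrySet {X : Type*} [MetricSpace X] (νm νp : Measure (Boundary X)) (x : X) :
    Set (Boundary X) :=
  ⋃ (C : Set X) (_ : C ∈ treeComps x) (_ : sflow νm νp (compBdry C) < 0), compBdry C

/-- The flow through the point `x`. -/
def flowAt {X : Type*} [MetricSpace X] (νm νp : Measure (Boundary X)) (x : X) : ℝ :=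
  sflow νm νp (posBdrySet νm νp x)

open Classical in
/-- The specific flow through `x`: the flow through `x`, not counting the edge pointing
towards the base point `x₀` when the latter is positive (resp. negative). -/
def specificFlow {X : Type*} [MetricSpace X] (νm νp : Measure (Boundary X))
    (x₀ x : X) : ℝ :=
  if x = x₀ then flowAt νm νp x
  else if 0 < sflow νm νp (compBdry (connectedComponentIn {x}ᶜ x₀)) then
    sflow νm νp (posBdrySet νm νp x \ compBdry (connectedComponentIn {x}ᶜ x₀))
  else if sflow νm νp (compBdry (connectedComponentIn {x}ᶜ x₀)) < 0 then
    - sflow νm νp (negBdrySet νm νp x \ compBdry (connectedComponentIn {x}ᶜ x₀))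
  else flowAt νm νp x

/-- The pair `(ν₋, ν₊)` is realized as the pair of ends of a complete unit-speed geodesic of
the Wasserstein space, through a displacement interpolation `m`. -/
def RealizableEnds {X : Type*} [MetricSpace X] [MeasurableSpace X]
    (νm νp : Measure (Boundary X)) : Prop :=
  ∃ (μt : ℝ → W2Space X) (m : Measure (GeoLine X)), IsProbabilityMeasure m ∧
    (∀ s t : ℝ, Wdist (μt s) (μt t) = |s - t|) ∧
    (∀ t : ℝ, m.map (fun γ : GeoLine X => γ.1 t) = (μt t).1) ∧
    m.map lineEndMinus = νm.map (fun ξ : Boundary X => coneMk ξ 1) ∧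
    m.map lineEndPlus = νp.map (fun ξ : Boundary X => coneMk ξ 1)

/-- The cost `∫ D₀² dπ` of a transport plan (the optimal transport problem for the cost
`-D₀²` is finite iff the supremum of this quantity over all couplings is finite, and its
minimizers are the maximizers of this quantity). -/
def D0cost {X : Type*} [MetricSpace X] (x₀ : X)
    (π : Measure (Boundary X × Boundary X)) : ℝ≥0∞ :=
  ∫⁻ p, ENNReal.ofReal (D0 x₀ p.1 p.2) ^ 2 ∂π

/-- The supremum of `∫ D₀² dπ` over couplings of `(ν₋, ν₊)`. -/
def D0supCost {X : Type*} [MetricSpace X] (x₀ : X) (νm νp : Measure (Boundary X)) : ℝ≥0∞ :=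
  ⨆ (π : Measure (Boundary X × Boundary X)) (_ : IsCoupling π νm νp), D0cost x₀ π

/-! ## The geodesic boundary of the Wasserstein space -/

/-- The metric topology of the Wasserstein distance. -/
instance (Y : Type*) [MetricSpace Y] [MeasurableSpace Y] : TopologicalSpace (W2Space Y) :=
  TopologicalSpace.generateFrom
    {S | ∃ (μ : W2Space Y) (ε : ℝ), S = {ν : W2Space Y | Wdist μ ν < ε}}

/-- Unit-speed geodesic rays of the Wasserstein space. -/
abbrev W2UnitRay (X : Type*) [MetricSpace X] [MeasurableSpace X] : Type _ :=
  {f : ℝ≥0 → W2Space X // ∀ s t : ℝ≥0, Wdist (f s) (f t) = dist s t}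

/-- Probability measures on the cone over the boundary with `∫ v² dν = 1`, with the weak
topology. -/
abbrev P1Cone (X : Type*) [MetricSpace X] : Type _ :=
  {ν : ProbabilityMeasure (Cone (Boundary X)) //
    ∫⁻ c, (coneSpeed c : ℝ≥0∞) ^ 2 ∂(ν : Measure (Cone (Boundary X))) = 1}

/-- Probability measures (as plain measures) on the cone over the boundary with
`∫ v² dν = 1`. -/
abbrev P1ConeM (X : Type*) [MetricSpace X] : Type _ :=
  {ν : Measure (Cone (Boundary X)) // IsProbabilityMeasure ν ∧
    ∫⁻ c, (coneSpeed c : ℝ≥0∞) ^ 2 ∂ν = 1}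


/-! ## Locally Riemannian points -/

/-- The Riemannian length of a path `γ : [0,1] → ℝⁿ` for the metric tensor `g`. -/
def riemannianPathLength {n : ℕ}
    (g : EuclideanSpace ℝ (Fin n) → EuclideanSpace ℝ (Fin n) →L[ℝ] EuclideanSpace ℝ (Fin n))
    (γ : ℝ → EuclideanSpace ℝ (Fin n)) : ℝ :=
  ∫ t in (0:ℝ)..1, Real.sqrt (@inner ℝ _ _ (g (γ t) (deriv γ t)) (deriv γ t))

/-- The Riemannian distance in `U ⊆ ℝⁿ` for the metric tensor `g`: the infimum of
Riemannian lengths of `C¹` paths in `U` joining the two points. -/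
def riemannianDist {n : ℕ} (U : Set (EuclideanSpace ℝ (Fin n)))
    (g : EuclideanSpace ℝ (Fin n) → EuclideanSpace ℝ (Fin n) →L[ℝ] EuclideanSpace ℝ (Fin n))
    (p q : EuclideanSpace ℝ (Fin n)) : ℝ :=
  sInf {L : ℝ | ∃ γ : ℝ → EuclideanSpace ℝ (Fin n), ContDiffOn ℝ 1 γ (Set.Icc (0:ℝ) 1) ∧
    (∀ t ∈ Set.Icc (0:ℝ) 1, γ t ∈ U) ∧ γ 0 = p ∧ γ 1 = q ∧ L = riemannianPathLength g γ}

/-- `x` admits a neighborhood isometric to an open subset of a Riemannian manifold of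
dimension at least 2 (expressed in a chart: an open subset of `ℝⁿ`, `n ≥ 2`, equipped with
the distance induced by a smooth positive-definite symmetric metric tensor). -/
def IsLocallyRiemannian (X : Type*) [MetricSpace X] (x : X) : Prop :=
  ∃ n : ℕ, 2 ≤ n ∧
  ∃ (U : Set (EuclideanSpace ℝ (Fin n)))
    (g : EuclideanSpace ℝ (Fin n) → EuclideanSpace ℝ (Fin n) →L[ℝ] EuclideanSpace ℝ (Fin n))
    (V : Set X) (φ : X → EuclideanSpace ℝ (Fin n)),
    IsOpen U ∧ ContDiffOn ℝ (⊤ : ℕ∞) g U ∧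
    (∀ p ∈ U, ∀ v w : EuclideanSpace ℝ (Fin n),
      @inner ℝ _ _ (g p v) w = @inner ℝ _ _ v (g p w)) ∧
    (∀ p ∈ U, ∀ v : EuclideanSpace ℝ (Fin n), v ≠ 0 → 0 < @inner ℝ _ _ (g p v) v) ∧
    V ∈ nhds x ∧ Set.BijOn φ V U ∧
    ∀ a ∈ V, ∀ b ∈ V, dist a b = riemannianDist U g (φ a) (φ b)

/-! ## The combinatorial perpendicular Radon transform on a tree -/

/-- `y` and `z` lie in the same connected component of the graph `G` minus the vertex `x`. -/
def sameComp {V : Type*} (G : SimpleGraph V) (x y z : V) : Prop :=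
  ∃ (hy : y ≠ x) (hz : z ≠ x), (G.induce {w : V | w ≠ x}).Reachable ⟨y, hy⟩ ⟨z, hz⟩

/-- The perpendicular `⊥ˣ(ef)` of a flag: the union of `{x}` and of the components of
`G - x` containing none of the vertices of `p` (for a flag, `p = {e, f}` is a pair of
neighbors of `x`). -/
def perpSet {V : Type*} (G : SimpleGraph V) (x : V) (p : Finset V) : Set V :=
  {x} ∪ {y | ∀ e ∈ p, ¬ sameComp G x y e}

/-- The combinatorial perpendicular Radon transform of a summable function `h` on the
vertices, evaluated on a flag `(x, p)`. -/
def perpRadon {V : Type*} (G : SimpleGraph V) (h : V → ℝ) (x : V) (p : Finset V) : ℝ :=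
  ∑' y : perpSet G x p, h y

/-! ## Integrals and couplings -/

lemma sq_integral_le_integral_sq {Ω : Type*} [MeasurableSpace Ω] {m : Measure Ω}
    [IsProbabilityMeasure m] {f : Ω → ℝ} (hf : Integrable f m)
    (hf2 : Integrable (fun w => f w ^ 2) m) : (∫ w, f w ∂m) ^ 2 ≤ ∫ w, f w ^ 2 ∂m := by
  set M := ∫ w, f w ∂m with hM
  have h0 : 0 ≤ ∫ w, (f w - M) ^ 2 ∂m := integral_nonneg fun w => sq_nonneg _
  have h1 : ∫ w, (f w - M) ^ 2 ∂m = ∫ w, f w ^ 2 ∂m - 2 * M * M + M ^ 2 := by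
    have : (fun w => (f w - M) ^ 2) = fun w => (f w ^ 2 - 2 * M * f w) + M ^ 2 := by
      funext w; ring
    rw [this, integral_add (f := fun w => f w ^ 2 - 2 * M * f w) (hf2.sub (hf.const_mul _))
      (integrable_const _), integral_sub hf2 (hf.const_mul _), integral_const_mul, integral_const]
    simp [hM]
  nlinarith

/-- A finite measure on a pseudometric space is determined by the integrals of Lipschitz functions
with values in `[0, 1]`. -/
lemma measure_eq_of_forall_lipschitz {Y : Type*} [PseudoMetricSpace Y] [MeasurableSpace Y]
    [BorelSpace Y] {m₁ m₂ : Measure Y} [IsProbabilityMeasure m₁] [IsProbabilityMeasure m₂]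
    (h : ∀ (g : Y → ℝ) (K : ℝ≥0), LipschitzWith K g → (∀ y, g y ∈ Set.Icc (0:ℝ) 1) →
      ∫ y, g y ∂m₁ = ∫ y, g y ∂m₂) : m₁ = m₂ := by
  have hF : ∀ F : Set Y, IsClosed F → m₁ F = m₂ F := by
    intro F hFc
    have hpos : ∀ n : ℕ, (0:ℝ) < 1 / ((n:ℝ) + 1) := fun n => by positivity
    have h1 := tendsto_integral_thickenedIndicator_of_isClosed m₁ hFc hpos
      tendsto_one_div_add_atTop_nhds_zero_nat
    have h2 := tendsto_integral_thickenedIndicator_of_isClosed m₂ hFc hpos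
      tendsto_one_div_add_atTop_nhds_zero_nat
    have he : ∀ n : ℕ, ∫ y, (thickenedIndicator (hpos n) F y : ℝ) ∂m₁
        = ∫ y, (thickenedIndicator (hpos n) F y : ℝ) ∂m₂ := by
      intro n
      refine h _ (Real.toNNReal (1 / ((n:ℝ) + 1)))⁻¹ ?_ ?_
      · have := lipschitzWith_thickenedIndicator (hpos n) F
        exact fun x y => this x y
      · intro y
        exact ⟨NNReal.coe_nonneg _, by exact_mod_cast thickenedIndicator_le_one (hpos n) F y⟩
    simp_rw [he] at h1
    have := tendsto_nhds_unique h1 h2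
    exact (measureReal_eq_measureReal_iff).1 this
  refine ext_of_generate_finite (m0 := inferInstance) _
    (BorelSpace.measurable_eq (α := Y) ▸ borel_eq_generateFrom_isClosed)
    isPiSystem_isClosed (fun F hFc => hF F hFc) (by simp)

section Couplings

variable {Y : Type*} [PseudoMetricSpace Y] [MeasurableSpace Y] [BorelSpace Y]
  [SecondCountableTopology Y]

lemma IsCoupling.isProbabilityMeasure {A B : Type*} [MeasurableSpace A] [MeasurableSpace B]
    {π : Measure (A × B)} {μ : Measure A} {ν : Measure B} [IsProbabilityMeasure μ]
    (h : IsCoupling π μ ν) : IsProbabilityMeasure π := by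
  constructor
  have h1 : π.map Prod.fst univ = 1 := by rw [h.1]; exact measure_univ
  rwa [Measure.map_apply measurable_fst MeasurableSet.univ, preimage_univ] at h1

lemma IsCoupling.ae_fst {A B : Type*} [MeasurableSpace A] [MeasurableSpace B]
    {π : Measure (A × B)} {μ : Measure A} {ν : Measure B}
    (h : IsCoupling π μ ν) {p : A → Prop} (hp : ∀ᵐ a ∂μ, p a) : ∀ᵐ q ∂π, p q.1 := by
  rw [← h.1] at hp
  exact ae_of_ae_map measurable_fst.aemeasurable hp

lemma IsCoupling.ae_snd {A B : Type*} [MeasurableSpace A] [MeasurableSpace B]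
    {π : Measure (A × B)} {μ : Measure A} {ν : Measure B}
    (h : IsCoupling π μ ν) {p : B → Prop} (hp : ∀ᵐ a ∂ν, p a) : ∀ᵐ q ∂π, p q.2 := by
  rw [← h.2] at hp
  exact ae_of_ae_map measurable_snd.aemeasurable hp

lemma IsCoupling.integral_fst {A B : Type*} [MeasurableSpace A] [MeasurableSpace B]
    {π : Measure (A × B)} {μ : Measure A} {ν : Measure B}
    (h : IsCoupling π μ ν) {f : A → ℝ} (hf : Measurable f) :
    ∫ q, f q.1 ∂π = ∫ a, f a ∂μ := by
  rw [← h.1, integral_map measurable_fst.aemeasurable hf.aestronglyMeasurable]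

lemma IsCoupling.integral_snd {A B : Type*} [MeasurableSpace A] [MeasurableSpace B]
    {π : Measure (A × B)} {μ : Measure A} {ν : Measure B}
    (h : IsCoupling π μ ν) {f : B → ℝ} (hf : Measurable f) :
    ∫ q, f q.2 ∂π = ∫ a, f a ∂ν := by
  rw [← h.2, integral_map measurable_snd.aemeasurable hf.aestronglyMeasurable]

lemma IsCoupling.integrable_fst {A B : Type*} [MeasurableSpace A] [MeasurableSpace B]
    {π : Measure (A × B)} {μ : Measure A} {ν : Measure B}
    (h : IsCoupling π μ ν) {f : A → ℝ} (hf : Integrable f μ) :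
    Integrable (fun q : A × B => f q.1) π := by
  rw [← h.1] at hf
  exact hf.comp_measurable measurable_fst

lemma IsCoupling.integrable_snd {A B : Type*} [MeasurableSpace A] [MeasurableSpace B]
    {π : Measure (A × B)} {μ : Measure A} {ν : Measure B}
    (h : IsCoupling π μ ν) {f : B → ℝ} (hf : Integrable f ν) :
    Integrable (fun q : A × B => f q.2) π := by
  rw [← h.2] at hf
  exact hf.comp_measurable measurable_snd

lemma integrable_of_integrable_sq {Ω : Type*} [MeasurableSpace Ω] {m : Measure Ω}
    [IsFiniteMeasure m] {f : Ω → ℝ} (hf : AEStronglyMeasurable f m)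
    (hf2 : Integrable (fun w => f w ^ 2) m) : Integrable f m := by
  refine Integrable.mono' (hf2.add (integrable_const 1)) hf (ae_of_all _ fun w => ?_)
  simp only [Real.norm_eq_abs, Pi.add_apply]
  nlinarith [sq_nonneg (|f w| - 1), sq_abs (f w), abs_nonneg (f w)]

lemma IsCoupling.abs_integral_sub_le {π : Measure (Y × Y)} {μ ν : Measure Y}
    [IsProbabilityMeasure μ] [IsProbabilityMeasure ν]
    (h : IsCoupling π μ ν) (hint : Integrable (fun q : Y × Y => dist q.1 q.2 ^ 2) π)
    {g : Y → ℝ} {K : ℝ≥0} (hg : LipschitzWith K g) (hg01 : ∀ y, g y ∈ Set.Icc (0:ℝ) 1) :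
    |∫ y, g y ∂μ - ∫ y, g y ∂ν| ≤ K * Real.sqrt (∫ q, dist q.1 q.2 ^ 2 ∂π) := by
  have := h.isProbabilityMeasure
  have hgm : Measurable g := hg.continuous.measurable
  have hgi : ∀ (m : Measure Y) [IsProbabilityMeasure m], Integrable g m := fun m _ => by
    refine Integrable.mono' (integrable_const (1:ℝ)) hgm.aestronglyMeasurable
      (ae_of_all _ fun y => ?_)
    rw [Real.norm_eq_abs, abs_of_nonneg (hg01 y).1]
    exact (hg01 y).2
  have hd : Measurable fun q : Y × Y => dist q.1 q.2 := by fun_prop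
  have hdi : Integrable (fun q : Y × Y => dist q.1 q.2) π :=
    integrable_of_integrable_sq hd.aestronglyMeasurable hint
  rw [← h.integral_fst hgm, ← h.integral_snd hgm,
    ← integral_sub (h.integrable_fst (hgi μ)) (h.integrable_snd (hgi ν))]
  calc |∫ q, (g q.1 - g q.2) ∂π| ≤ ∫ q, K * dist q.1 q.2 ∂π := by
        refine abs_integral_le_integral_abs.trans (integral_mono_of_nonneg
          (ae_of_all _ fun _ => abs_nonneg _) (hdi.const_mul _) (ae_of_all _ fun q => ?_))
        have := hg.dist_le_mul q.1 q.2
        rwa [Real.dist_eq] at this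
    _ = K * ∫ q, dist q.1 q.2 ∂π := integral_const_mul _ _
    _ ≤ _ := by
        gcongr
        exact Real.le_sqrt_of_sq_le (sq_integral_le_integral_sq hdi hint)

/-- Two probability measures admitting couplings of arbitrarily small quadratic cost agree. -/
lemma measure_eq_of_forall_coupling {μ ν : Measure Y}
    [IsProbabilityMeasure μ] [IsProbabilityMeasure ν]
    (h : ∀ ε : ℝ, 0 < ε → ∃ π : Measure (Y × Y), IsCoupling π μ ν ∧
      Integrable (fun q : Y × Y => dist q.1 q.2 ^ 2) π ∧ ∫ q, dist q.1 q.2 ^ 2 ∂π ≤ ε) :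
    μ = ν := by
  refine measure_eq_of_forall_lipschitz fun g K hg hg01 => ?_
  by_contra hne
  have hpos : 0 < |∫ y, g y ∂μ - ∫ y, g y ∂ν| := abs_pos.2 (sub_ne_zero.2 hne)
  set D := |∫ y, g y ∂μ - ∫ y, g y ∂ν|
  obtain ⟨π, hπ, hint, hle⟩ := h ((D / (K + 1) / 2) ^ 2) (by positivity)
  have h1 := hπ.abs_integral_sub_le hint hg hg01
  have h2 : Real.sqrt (∫ q, dist q.1 q.2 ^ 2 ∂π) ≤ D / (K + 1) / 2 :=
    Real.sqrt_le_iff.2 ⟨by positivity, hle⟩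
  have h3 : (K:ℝ) * (D / (K + 1) / 2) ≤ D / 2 := by
    have : (K:ℝ) * (D / (K + 1) / 2) = (K / (K + 1)) * (D / 2) := by field_simp
    rw [this]
    have : (K:ℝ) / (K + 1) ≤ 1 := by
      rw [div_le_one (by positivity)]; linarith
    nlinarith
  have h4 : (K:ℝ) * Real.sqrt (∫ q, dist q.1 q.2 ^ 2 ∂π) ≤ K * (D / (K + 1) / 2) := by gcongr
  change D ≤ _ at h1
  linarith

/-- A finite measure on the line is determined by the integrals of the functions `(s - c)⁺`. -/
lemma measure_eq_of_forall_integral_posPart {m₁ m₂ : Measure ℝ}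
    [IsProbabilityMeasure m₁] [IsProbabilityMeasure m₂]
    (h₁ : Integrable (fun s : ℝ => s) m₁) (h₂ : Integrable (fun s : ℝ => s) m₂)
    (h : ∀ c : ℝ, ∫ s, max (s - c) 0 ∂m₁ = ∫ s, max (s - c) 0 ∂m₂) : m₁ = m₂ := by
  have key : ∀ (m : Measure ℝ) [IsProbabilityMeasure m], Integrable (fun s : ℝ => s) m → ∀ c : ℝ,
      Tendsto (fun n : ℕ => ((n:ℝ) + 1) * (∫ s, max (s - c) 0 ∂m
        - ∫ s, max (s - (c + 1 / ((n:ℝ) + 1))) 0 ∂m)) atTop (𝓝 (m.real (Ioi c))) := by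
    intro m _ hm c
    have hi : ∀ a : ℝ, Integrable (fun s => max (s - a) 0) m := fun a =>
      (hm.sub (integrable_const a)).pos_part
    have e : ∀ n : ℕ, ((n:ℝ) + 1) * (∫ s, max (s - c) 0 ∂m
        - ∫ s, max (s - (c + 1 / ((n:ℝ) + 1))) 0 ∂m) = ∫ s, ((n:ℝ) + 1) * (max (s - c) 0
          - max (s - (c + 1 / ((n:ℝ) + 1))) 0) ∂m := by
      intro n
      rw [integral_const_mul, integral_sub (hi _) (hi _)]
    simp_rw [e]
    have : m.real (Ioi c) = ∫ s, (Ioi c).indicator (fun _ => (1:ℝ)) s ∂m := by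
      rw [integral_indicator measurableSet_Ioi]; simp
    rw [this]
    refine tendsto_integral_of_dominated_convergence (fun _ => 1)
      (fun n => by fun_prop) (integrable_const _) (fun n => ae_of_all _ fun s => ?_)
      (ae_of_all _ fun s => ?_)
    · have hn : (0:ℝ) < (n:ℝ) + 1 := by positivity
      have hle : |max (s - c) 0 - max (s - (c + 1 / ((n:ℝ) + 1))) 0| ≤ 1 / ((n:ℝ) + 1) := by
        refine (abs_max_sub_max_le_abs _ _ _).trans ?_
        rw [show s - c - (s - (c + 1 / ((n:ℝ) + 1))) = 1 / ((n:ℝ) + 1) by ring]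
        rw [abs_of_pos (by positivity)]
      rw [norm_mul, Real.norm_eq_abs, Real.norm_eq_abs, abs_of_pos hn]
      calc ((n:ℝ) + 1) * _ ≤ ((n:ℝ) + 1) * (1 / ((n:ℝ) + 1)) := by gcongr
        _ = 1 := by field_simp
    · by_cases hs : s ∈ Ioi c
      · have hs' : 0 < s - c := sub_pos.2 hs
        rw [indicator_of_mem hs]
        refine tendsto_const_nhds.congr' ?_
        have ht : ∀ᶠ n : ℕ in atTop, 1 / ((n:ℝ) + 1) < s - c :=
          tendsto_one_div_add_atTop_nhds_zero_nat.eventually_lt_const hs'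
        filter_upwards [ht] with n hn
        have hn' : (0:ℝ) < (n:ℝ) + 1 := by positivity
        rw [max_eq_left hs'.le, max_eq_left (by linarith)]
        field_simp
        ring
      · rw [indicator_of_notMem hs]
        refine tendsto_const_nhds.congr fun n => ?_
        have hs' : s ≤ c := not_lt.1 hs
        have hn' : (0:ℝ) < 1 / ((n:ℝ) + 1) := by positivity
        rw [max_eq_right (by linarith), max_eq_right (by linarith)]
        simp
  have hI : ∀ c : ℝ, m₁ (Ioi c) = m₂ (Ioi c) := by
    intro c
    have k1 := key m₁ h₁ c
    simp_rw [h] at k1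
    exact (measureReal_eq_measureReal_iff).1 (tendsto_nhds_unique k1 (key m₂ h₂ c))
  refine Measure.ext_of_Iic _ _ fun c => ?_
  rw [← compl_Ioi, prob_compl_eq_one_sub measurableSet_Ioi,
    prob_compl_eq_one_sub measurableSet_Ioi, hI]

end Couplings

/-! ## The squared Wasserstein distance -/

section Wasserstein

variable {X : Type*} [MetricSpace X] [MeasurableSpace X]

/-- The squared Wasserstein distance. -/
def W2sq (μ ν : W2Space X) : ℝ := (W2cost μ.1 ν.1).toReal

lemma W2sq_eq_iff {μ ν μ' ν' : W2Space X} :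
    Wdist μ ν = Wdist μ' ν' ↔ W2sq μ ν = W2sq μ' ν' :=
  Real.sqrt_inj ENNReal.toReal_nonneg ENNReal.toReal_nonneg

variable [BorelSpace X]

lemma lintegral_ofReal_sq {Ω : Type*} [MeasurableSpace Ω] {m : Measure Ω} {f : Ω → ℝ}
    (hf0 : ∀ w, 0 ≤ f w) (hf : Integrable (fun w => f w ^ 2) m) :
    ∫⁻ w, ENNReal.ofReal (f w) ^ 2 ∂m = ENNReal.ofReal (∫ w, f w ^ 2 ∂m) := by
  rw [ofReal_integral_eq_lintegral_ofReal hf (ae_of_all _ fun w => sq_nonneg _)]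
  refine lintegral_congr fun w => ?_
  rw [ENNReal.ofReal_pow (hf0 w)]

lemma integrable_dist_sq_of_integrable {μ : Measure X} [IsFiniteMeasure μ] {x₀ : X}
    (h : Integrable (fun w => dist x₀ w ^ 2) μ) (x : X) :
    Integrable (fun w => dist x w ^ 2) μ := by
  refine Integrable.mono' ((h.const_mul 2).add (integrable_const (2 * dist x x₀ ^ 2)))
    (by fun_prop) (ae_of_all _ fun w => ?_)
  simp only [Real.norm_eq_abs, abs_sq, Pi.add_apply]
  nlinarith [sq_nonneg (dist x x₀ - dist x₀ w), dist_triangle x x₀ w,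
    dist_nonneg (x := x) (y := w), dist_nonneg (x := x) (y := x₀), dist_nonneg (x := x₀) (y := w)]

namespace W2Space

instance (μ : W2Space X) : IsProbabilityMeasure μ.1 := μ.2.1

lemma integrable_dist_sq (μ : W2Space X) (x : X) : Integrable (fun w => dist x w ^ 2) μ.1 := by
  obtain ⟨x₀, hx₀⟩ := μ.2.2
  refine integrable_dist_sq_of_integrable (x₀ := x₀) ⟨by fun_prop, ?_⟩ x
  rw [hasFiniteIntegral_iff_ofReal (ae_of_all _ fun w => sq_nonneg _)]
  simpa only [ENNReal.ofReal_pow dist_nonneg] using hx₀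

lemma integrable_dist (μ : W2Space X) (x : X) : Integrable (fun w => dist x w) μ.1 :=
  integrable_of_integrable_sq (by fun_prop) (μ.integrable_dist_sq x)

/-- The point of the Wasserstein space given by a probability measure with a finite second
moment. -/
def ofIntegrable (μ : Measure X) [hμ : IsProbabilityMeasure μ] (x₀ : X)
    (h : Integrable (fun w => dist x₀ w ^ 2) μ) : W2Space X :=
  ⟨μ, hμ, x₀, by
    rw [lintegral_ofReal_sq (fun _ => dist_nonneg) h]
    exact ENNReal.ofReal_lt_top⟩

/-- The Dirac mass at `x`. -/
def dirac (x : X) : W2Space X :=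
  ofIntegrable (Measure.dirac x) x
    ⟨by fun_prop, by
      rw [hasFiniteIntegral_iff_ofReal (ae_of_all _ fun w => sq_nonneg _),
        lintegral_dirac' _ (by fun_prop)]
      exact ENNReal.ofReal_lt_top⟩

lemma integrable_dist_sq_map (μ : W2Space X) {T : X → X} (hT : Measurable T) {x₀ : X}
    (h : Integrable (fun w => dist x₀ (T w) ^ 2) μ.1) :
    Integrable (fun w => dist x₀ w ^ 2) (μ.1.map T) :=
  (integrable_map_measure (by fun_prop) hT.aemeasurable).2 h

/-- The push-forward of a measure. -/
def map (μ : W2Space X) (T : X → X) (hT : Measurable T) (x₀ : X)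
    (h : Integrable (fun w => dist x₀ (T w) ^ 2) μ.1) : W2Space X :=
  have : IsProbabilityMeasure (μ.1.map T) := Measure.isProbabilityMeasure_map hT.aemeasurable
  ofIntegrable (μ.1.map T) x₀ (μ.integrable_dist_sq_map hT h)

end W2Space

variable [SecondCountableTopology X]

lemma IsCoupling.integrable_dist_sq {π : Measure (X × X)} {μ ν : W2Space X}
    (h : IsCoupling π μ.1 ν.1) : Integrable (fun q : X × X => dist q.1 q.2 ^ 2) π := by
  obtain ⟨x, -⟩ := μ.2.2
  refine Integrable.mono' (((h.integrable_fst (μ.integrable_dist_sq x)).const_mul 2).add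
    ((h.integrable_snd (ν.integrable_dist_sq x)).const_mul 2)) (by fun_prop)
    (ae_of_all _ fun q => ?_)
  simp only [Real.norm_eq_abs, abs_sq, Pi.add_apply]
  nlinarith [sq_nonneg (dist x q.1 - dist x q.2), dist_triangle_left q.1 q.2 x,
    dist_nonneg (x := q.1) (y := q.2), dist_nonneg (x := x) (y := q.1),
    dist_nonneg (x := x) (y := q.2)]

lemma IsCoupling.lintegral_dist_sq {π : Measure (X × X)} {μ ν : W2Space X}
    (h : IsCoupling π μ.1 ν.1) :
    ∫⁻ p, ENNReal.ofReal (dist p.1 p.2) ^ 2 ∂π = ENNReal.ofReal (∫ q, dist q.1 q.2 ^ 2 ∂π) :=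
  lintegral_ofReal_sq (fun _ => dist_nonneg) h.integrable_dist_sq

lemma W2sq_le {π : Measure (X × X)} {μ ν : W2Space X} (h : IsCoupling π μ.1 ν.1) :
    W2sq μ ν ≤ ∫ q, dist q.1 q.2 ^ 2 ∂π := by
  have h1 : W2cost μ.1 ν.1 ≤ ENNReal.ofReal (∫ q, dist q.1 q.2 ^ 2 ∂π) := by
    rw [← h.lintegral_dist_sq]
    exact iInf₂_le π h
  exact ENNReal.toReal_le_of_le_ofReal (integral_nonneg fun _ => sq_nonneg _) h1

lemma isCoupling_prod {A B : Type*} [MeasurableSpace A] [MeasurableSpace B]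
    (μ : Measure A) (ν : Measure B) [IsProbabilityMeasure μ] [IsProbabilityMeasure ν] :
    IsCoupling (μ.prod ν) μ ν :=
  ⟨by rw [Measure.map_fst_prod]; simp, by rw [Measure.map_snd_prod]; simp⟩

lemma W2cost_ne_top (μ ν : W2Space X) : W2cost μ.1 ν.1 ≠ ⊤ := by
  have h := isCoupling_prod μ.1 ν.1
  have hle : W2cost μ.1 ν.1 ≤ ENNReal.ofReal (∫ q, dist q.1 q.2 ^ 2 ∂(μ.1.prod ν.1)) := by
    rw [← h.lintegral_dist_sq]
    exact iInf₂_le (μ.1.prod ν.1) h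
  exact ne_top_of_le_ne_top ENNReal.ofReal_ne_top hle

lemma exists_coupling_lt (μ ν : W2Space X) {c : ℝ} (hc : W2sq μ ν < c) :
    ∃ π : Measure (X × X), IsCoupling π μ.1 ν.1 ∧ ∫ q, dist q.1 q.2 ^ 2 ∂π < c := by
  have h1 : W2cost μ.1 ν.1 < ENNReal.ofReal c :=
    (ENNReal.lt_ofReal_iff_toReal_lt (W2cost_ne_top μ ν)).2 hc
  simp only [W2cost, iInf_lt_iff] at h1
  obtain ⟨π, hπ, hlt⟩ := h1
  refine ⟨π, hπ, ?_⟩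
  rw [hπ.lintegral_dist_sq] at hlt
  exact (ENNReal.ofReal_lt_ofReal_iff_of_nonneg (integral_nonneg fun _ => sq_nonneg _)).1 hlt

lemma le_W2sq (μ ν : W2Space X) {c : ℝ}
    (h : ∀ π : Measure (X × X), IsCoupling π μ.1 ν.1 → c ≤ ∫ q, dist q.1 q.2 ^ 2 ∂π) :
    c ≤ W2sq μ ν := by
  by_contra! hlt
  obtain ⟨π, hπ, hc⟩ := exists_coupling_lt μ ν hlt
  exact absurd (h π hπ) (not_le.2 hc)

lemma IsCoupling.swap {A B : Type*} [MeasurableSpace A] [MeasurableSpace B]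
    {π : Measure (A × B)} {μ : Measure A} {ν : Measure B} (h : IsCoupling π μ ν) :
    IsCoupling (π.map Prod.swap) ν μ := by
  constructor
  · rw [Measure.map_map measurable_fst measurable_swap]; exact h.2
  · rw [Measure.map_map measurable_snd measurable_swap]; exact h.1

lemma W2sq_comm (μ ν : W2Space X) : W2sq μ ν = W2sq ν μ := by
  have key : ∀ μ ν : W2Space X, W2sq μ ν ≤ W2sq ν μ := by
    intro μ ν
    refine le_W2sq _ _ fun π hπ => (W2sq_le hπ.swap).trans_eq ?_
    rw [integral_map measurable_swap.aemeasurable (by fun_prop)]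
    simp only [Prod.fst_swap, Prod.snd_swap, dist_comm]
  exact le_antisymm (key _ _) (key _ _)

lemma isCoupling_map {Ω A B : Type*} [MeasurableSpace Ω] [MeasurableSpace A] [MeasurableSpace B]
    (μ : Measure Ω) {S : Ω → A} {T : Ω → B} (hS : Measurable S) (hT : Measurable T) :
    IsCoupling (μ.map fun w => (S w, T w)) (μ.map S) (μ.map T) := by
  constructor
  · rw [Measure.map_map measurable_fst (hS.prodMk hT)]; rfl
  · rw [Measure.map_map measurable_snd (hS.prodMk hT)]; rfl

/-- A map pushing `μ` to `ν` bounds the Wasserstein distance from above. -/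
lemma W2sq_le_of_map (μ ν : W2Space X) {T : X → X} (hT : Measurable T)
    (h : μ.1.map T = ν.1) : W2sq μ ν ≤ ∫ w, dist w (T w) ^ 2 ∂μ.1 := by
  have hc : IsCoupling (μ.1.map fun w => (w, T w)) μ.1 ν.1 := by
    have := isCoupling_map μ.1 measurable_id hT
    rwa [Measure.map_id, h] at this
  refine (W2sq_le hc).trans_eq ?_
  exact integral_map (measurable_id.prodMk hT).aemeasurable (by fun_prop)

lemma W2sq_dirac (μ : W2Space X) (x : X) :
    W2sq μ (W2Space.dirac x) = ∫ w, dist x w ^ 2 ∂μ.1 := by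
  refine le_antisymm ?_ (le_W2sq _ _ fun π hπ => ?_)
  · refine (W2sq_le_of_map μ _ (T := fun _ => x) measurable_const ?_).trans_eq ?_
    · rw [Measure.map_const]; simp; rfl
    · simp only [dist_comm]
  · have h2 : ∀ᵐ q ∂π, q.2 = x :=
      hπ.ae_snd (p := fun w => w = x) (by
        change ∀ᵐ w ∂(Measure.dirac x), w = x
        exact (ae_dirac_iff (p := fun w => w = x) (measurableSet_singleton x)).2 rfl)
    rw [← hπ.integral_fst (f := fun w => dist x w ^ 2) (by fun_prop)]
    refine (integral_congr_ae ?_).le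
    filter_upwards [h2] with q hq
    rw [hq, dist_comm]

lemma W2sq_dirac_dirac (x y : X) : W2sq (W2Space.dirac x) (W2Space.dirac y) = dist x y ^ 2 := by
  rw [W2sq_dirac]
  change ∫ w, dist y w ^ 2 ∂(Measure.dirac x) = _
  rw [integral_dirac, dist_comm]

/-- The push-forward by an isometry, as a bijection of the Wasserstein space. -/
def pushforwardEquiv (φ : X ≃ᵢ X) : W2Space X ≃ W2Space X where
  toFun μ := ⟨μ.1.map φ, Measure.isProbabilityMeasure_map φ.continuous.aemeasurable, by
    obtain ⟨x, hx⟩ := μ.2.2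
    refine ⟨φ x, ?_⟩
    rw [lintegral_map (by fun_prop) φ.continuous.measurable]
    simpa only [φ.isometry.dist_eq] using hx⟩
  invFun μ := ⟨μ.1.map φ.symm, Measure.isProbabilityMeasure_map φ.symm.continuous.aemeasurable, by
    obtain ⟨x, hx⟩ := μ.2.2
    refine ⟨φ.symm x, ?_⟩
    rw [lintegral_map (by fun_prop) φ.symm.continuous.measurable]
    simpa only [φ.symm.isometry.dist_eq] using hx⟩
  left_inv μ := Subtype.ext (by
    change (μ.1.map φ).map φ.symm = μ.1
    rw [Measure.map_map φ.symm.continuous.measurable φ.continuous.measurable]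
    convert Measure.map_id
    ext w
    simp)
  right_inv μ := Subtype.ext (by
    change (μ.1.map φ.symm).map φ = μ.1
    rw [Measure.map_map φ.continuous.measurable φ.symm.continuous.measurable]
    convert Measure.map_id
    ext w
    simp)

lemma W2sq_pushforwardEquiv (φ : X ≃ᵢ X) (μ ν : W2Space X) :
    W2sq (pushforwardEquiv φ μ) (pushforwardEquiv φ ν) = W2sq μ ν := by
  have key : ∀ (φ : X ≃ᵢ X) (μ ν : W2Space X),
      W2sq (pushforwardEquiv φ μ) (pushforwardEquiv φ ν) ≤ W2sq μ ν := by
    intro φ μ ν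
    refine le_W2sq _ _ fun π hπ => ?_
    have hm : Measurable (Prod.map φ φ) := by
      exact φ.continuous.measurable.prodMap φ.continuous.measurable
    have hc : IsCoupling (π.map (Prod.map φ φ)) (pushforwardEquiv φ μ).1
        (pushforwardEquiv φ ν).1 := by
      constructor
      · change _ = μ.1.map φ
        rw [← hπ.1, Measure.map_map measurable_fst hm,
          Measure.map_map φ.continuous.measurable measurable_fst]
        rfl
      · change _ = ν.1.map φ
        rw [← hπ.2, Measure.map_map measurable_snd hm,
          Measure.map_map φ.continuous.measurable measurable_snd]
        rfl
    refine (W2sq_le hc).trans_eq ?_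
    rw [integral_map hm.aemeasurable (by fun_prop)]
    simp only [Prod.map_fst, Prod.map_snd, φ.isometry.dist_eq]
  refine le_antisymm (key φ μ ν) ?_
  have h := key φ.symm (pushforwardEquiv φ μ) (pushforwardEquiv φ ν)
  have e : ∀ μ : W2Space X, pushforwardEquiv φ.symm (pushforwardEquiv φ μ) = μ := fun μ =>
    (pushforwardEquiv φ).symm_apply_apply μ
  rwa [e, e] at h

lemma pushforwardEquiv_dirac (φ : X ≃ᵢ X) (x : X) :
    pushforwardEquiv φ (W2Space.dirac x) = W2Space.dirac (φ x) :=
  Subtype.ext (by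
    change (Measure.dirac x).map φ = Measure.dirac (φ x)
    exact Measure.map_dirac' φ.continuous.measurable x)

lemma exists_measurable_countable_approx (X : Type*) [MetricSpace X] [MeasurableSpace X]
    [BorelSpace X] [SecondCountableTopology X] [Nonempty X] {ε : ℝ} (hε : 0 < ε) :
    ∃ (D : ℕ → X) (n : X → ℕ), Measurable n ∧ ∀ w, dist w (D (n w)) < ε := by
  classical
  have hD := TopologicalSpace.denseRange_denseSeq X
  have hex : ∀ w : X, ∃ k : ℕ, dist w (TopologicalSpace.denseSeq X k) < ε := fun w =>
    hD.exists_dist_lt w hε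
  exact ⟨TopologicalSpace.denseSeq X, fun w => Nat.find (hex w),
    measurable_find hex fun k => measurableSet_lt (by fun_prop) measurable_const,
    fun w => Nat.find_spec (hex w)⟩

end Wasserstein

/-! ## Isometries preserve Dirac masses -/

section DiracMasses

variable {X : Type*} [MetricSpace X] [MeasurableSpace X]

/-- `μ` is, up to arbitrarily small errors, one end of a geodesic of which `ν` is the midpoint,
for every `ν`. -/
def ApproxExtendable (μ : W2Space X) : Prop :=
  ∀ ν : W2Space X, ∀ ε : ℝ, 0 < ε → ∃ ν' : W2Space X,
    4 * W2sq μ ν - ε ≤ W2sq μ ν' ∧ W2sq ν ν' ≤ W2sq μ ν + ε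

lemma ApproxExtendable.apply {μ : W2Space X} (hμ : ApproxExtendable μ) (Φ : W2Space X ≃ W2Space X)
    (hΦ : ∀ μ ν, W2sq (Φ μ) (Φ ν) = W2sq μ ν) : ApproxExtendable (Φ μ) := by
  intro ν ε hε
  obtain ⟨ν', h1, h2⟩ := hμ (Φ.symm ν) ε hε
  refine ⟨Φ ν', ?_, ?_⟩
  · have := hΦ μ (Φ.symm ν)
    rw [Φ.apply_symm_apply] at this
    rwa [this, hΦ]
  · have h3 := hΦ μ (Φ.symm ν)
    have h4 := hΦ (Φ.symm ν) ν'
    rw [Φ.apply_symm_apply] at h3 h4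
    rwa [h3, h4]

variable [BorelSpace X] [SecondCountableTopology X]

lemma approxExtendable_dirac
    (hext : ∀ p y : X, ∃ e : X, dist p e = 2 * dist p y ∧ dist y e = dist p y) (p : X) :
    ApproxExtendable (W2Space.dirac p) := by
  intro ν ε hε
  have : Nonempty X := ⟨p⟩
  set M := ∫ w, dist p w ∂ν.1 with hM
  have hM0 : 0 ≤ M := integral_nonneg fun _ => dist_nonneg
  obtain ⟨δ, hδ0, hδ1, hδM⟩ : ∃ δ : ℝ, 0 < δ ∧ δ ≤ 1 ∧ δ * (8 * M + 4) ≤ ε := by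
    refine ⟨min 1 (ε / (8 * M + 4)), by positivity, min_le_left _ _, ?_⟩
    calc min 1 (ε / (8 * M + 4)) * (8 * M + 4) ≤ ε / (8 * M + 4) * (8 * M + 4) := by
          gcongr; exact min_le_right _ _
      _ = ε := by field_simp
  obtain ⟨D, n, hn, hD⟩ := exists_measurable_countable_approx X hδ0
  choose e he1 he2 using hext p
  have hE : Measurable fun w => e (D (n w)) :=
    (measurable_from_nat (f := fun k => e (D k))).comp hn
  have hlow : ∀ w, 2 * dist p w - 2 * δ ≤ dist p (e (D (n w))) := fun w => by
    rw [he1]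
    have := dist_triangle_right p w (D (n w))
    linarith [hD w]
  have hup : ∀ w, dist p (D (n w)) ≤ dist p w + δ := fun w => by
    have := dist_triangle p w (D (n w))
    linarith [hD w]
  have hd2 := ν.integrable_dist_sq p
  have hd1 := ν.integrable_dist p
  have hint : Integrable (fun w => dist p (e (D (n w))) ^ 2) ν.1 := by
    refine Integrable.mono' ((hd2.const_mul 8).add (integrable_const (8 * δ ^ 2)))
      ((measurable_const.dist hE).pow_const 2).aestronglyMeasurable (ae_of_all _ fun w => ?_)
    simp only [Real.norm_eq_abs, abs_sq, Pi.add_apply, he1]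
    nlinarith [hup w, dist_nonneg (x := p) (y := D (n w)), dist_nonneg (x := p) (y := w),
      sq_nonneg (dist p w - δ)]
  refine ⟨ν.map _ hE p hint, ?_, ?_⟩
  · rw [W2sq_comm _ ν, W2sq_comm _ (ν.map _ hE p hint), W2sq_dirac, W2sq_dirac]
    change _ ≤ ∫ w, dist p w ^ 2 ∂(ν.1.map fun w => e (D (n w)))
    rw [integral_map hE.aemeasurable (by fun_prop)]
    calc 4 * ∫ w, dist p w ^ 2 ∂ν.1 - ε ≤ 4 * ∫ w, dist p w ^ 2 ∂ν.1 - 8 * δ * M := by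
          nlinarith
      _ = ∫ w, (4 * dist p w ^ 2 - 8 * δ * dist p w) ∂ν.1 := by
          rw [integral_sub (hd2.const_mul 4) (hd1.const_mul _), integral_const_mul,
            integral_const_mul]
      _ ≤ _ := by
          refine integral_mono ((hd2.const_mul 4).sub (hd1.const_mul _)) hint fun w => ?_
          have h0 := dist_nonneg (x := p) (y := e (D (n w)))
          have h1 := dist_nonneg (x := p) (y := w)
          change 4 * dist p w ^ 2 - 8 * δ * dist p w ≤ dist p (e (D (n w))) ^ 2
          rcases le_total δ (dist p w) with h | h
          · nlinarith [hlow w, pow_le_pow_left₀ (by linarith) (hlow w) 2]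
          · nlinarith [mul_nonneg h1 (sub_nonneg.2 h), sq_nonneg (dist p (e (D (n w))))]
  · rw [W2sq_comm _ ν, W2sq_dirac]
    refine (W2sq_le_of_map ν (ν.map _ hE p hint) hE rfl).trans ?_
    have hb : ∀ w, dist w (e (D (n w))) ^ 2 ≤ dist p w ^ 2 + 4 * δ * dist p w + 4 * δ ^ 2 := by
      intro w
      have h1 : dist w (e (D (n w))) ≤ dist p w + 2 * δ := by
        have := dist_triangle w (D (n w)) (e (D (n w)))
        rw [he2] at this
        linarith [hD w, hup w]
      nlinarith [pow_le_pow_left₀ dist_nonneg h1 2]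
    have hI : Integrable (fun w => dist p w ^ 2 + 4 * δ * dist p w) ν.1 :=
      hd2.add (hd1.const_mul _)
    calc ∫ w, dist w (e (D (n w))) ^ 2 ∂ν.1
        ≤ ∫ w, (dist p w ^ 2 + 4 * δ * dist p w + 4 * δ ^ 2) ∂ν.1 :=
          integral_mono_of_nonneg (ae_of_all _ fun _ => sq_nonneg _)
            (hI.add (integrable_const _)) (ae_of_all _ hb)
      _ = ∫ w, dist p w ^ 2 ∂ν.1 + 4 * δ * M + 4 * δ ^ 2 := by
          rw [integral_add hI (integrable_const _), integral_add hd2 (hd1.const_mul _),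
            integral_const_mul, integral_const]
          simp [hM]
      _ ≤ _ := by nlinarith

lemma integral_dist_sq_le_of_approxExtendable {μ : W2Space X} (hμ : ApproxExtendable μ) (x : X) :
    ∫ w, dist x w ^ 2 ∂μ.1 ≤ (∫ w, dist x w ∂μ.1) ^ 2 := by
  by_contra! hV
  set A := ∫ w, dist x w ^ 2 ∂μ.1 with hA
  set M := ∫ w, dist x w ∂μ.1 with hM
  have hM0 : 0 ≤ M := integral_nonneg fun _ => dist_nonneg
  obtain ⟨ν', h1, h2⟩ := hμ (W2Space.dirac x) ((A - M ^ 2) / 4) (by linarith)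
  rw [W2sq_dirac, ← hA] at h1 h2
  rw [W2sq_comm, W2sq_dirac] at h2
  set B := ∫ w, dist x w ^ 2 ∂ν'.1 with hB
  set M' := ∫ w, dist x w ∂ν'.1 with hM'
  have hM'0 : 0 ≤ M' := integral_nonneg fun _ => dist_nonneg
  have hM'B : M' ^ 2 ≤ B :=
    sq_integral_le_integral_sq (ν'.integrable_dist x) (ν'.integrable_dist_sq x)
  have hc := isCoupling_prod μ.1 ν'.1
  have hi1 := hc.integrable_fst (μ.integrable_dist_sq x)
  have hi2 := hc.integrable_snd (ν'.integrable_dist_sq x)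
  have hi3 : Integrable (fun q : X × X => dist x q.1 * dist x q.2) (μ.1.prod ν'.1) :=
    (μ.integrable_dist x).mul_prod (ν'.integrable_dist x)
  have hle : W2sq μ ν' ≤ A + B + 2 * (M * M') := by
    calc W2sq μ ν' ≤ _ := W2sq_le hc
      _ ≤ ∫ q, (dist x q.1 ^ 2 + dist x q.2 ^ 2 + 2 * (dist x q.1 * dist x q.2))
            ∂(μ.1.prod ν'.1) := by
          refine integral_mono_of_nonneg (ae_of_all _ fun _ => sq_nonneg _)
            ((hi1.add hi2).add (hi3.const_mul 2)) (ae_of_all _ fun q => ?_)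
          change dist q.1 q.2 ^ 2
            ≤ dist x q.1 ^ 2 + dist x q.2 ^ 2 + 2 * (dist x q.1 * dist x q.2)
          nlinarith [pow_le_pow_left₀ dist_nonneg (dist_triangle_left q.1 q.2 x) 2]
      _ = A + B + 2 * (M * M') := by
          rw [integral_add (f := fun q : X × X => dist x q.1 ^ 2 + dist x q.2 ^ 2)
              (hi1.add hi2) (hi3.const_mul 2), integral_add hi1 hi2, integral_const_mul,
            hc.integral_fst (f := fun w => dist x w ^ 2) (by fun_prop),
            hc.integral_snd (f := fun w => dist x w ^ 2) (by fun_prop),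
            integral_prod_mul (fun w => dist x w) (fun w => dist x w)]
  set V := A - M ^ 2 with hVd
  have hV0 : 0 < V := by linarith
  have hMM : A - V / 4 ≤ M * M' := by linarith
  have hA1 : V ≤ A := by nlinarith [sq_nonneg M]
  have hsq : (A - V / 4) ^ 2 ≤ (M * M') ^ 2 := pow_le_pow_left₀ (by linarith) hMM 2
  have hsq2 : (M * M') ^ 2 ≤ (A - V) * (A + V / 4) := by
    rw [mul_pow]
    exact mul_le_mul (by linarith) (by linarith) (sq_nonneg _) (by linarith)
  nlinarith [mul_pos hV0 hV0]

lemma eq_dirac_of_approxExtendable {μ : W2Space X} (hμ : ApproxExtendable μ) :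
    ∃ p : X, μ = W2Space.dirac p := by
  have : Nonempty X := ⟨μ.2.2.choose⟩
  have hconst : ∀ x : X, ∀ᵐ w ∂μ.1, dist x w = ∫ w, dist x w ∂μ.1 := by
    intro x
    have h := integral_dist_sq_le_of_approxExtendable hμ x
    have hd2 := μ.integrable_dist_sq x
    have hd1 := μ.integrable_dist x
    set M := ∫ w, dist x w ∂μ.1 with hM
    have hI : Integrable (fun w => dist x w ^ 2 - 2 * M * dist x w) μ.1 :=
      hd2.sub (hd1.const_mul _)
    have he : (fun w => (dist x w - M) ^ 2)
        = fun w => (dist x w ^ 2 - 2 * M * dist x w) + M ^ 2 := by funext w; ring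
    have hI2 : Integrable (fun w => (dist x w - M) ^ 2) μ.1 := by
      rw [he]; exact hI.add (integrable_const _)
    have h0 : ∫ w, (dist x w - M) ^ 2 ∂μ.1 = 0 := by
      refine le_antisymm ?_ (integral_nonneg fun _ => sq_nonneg _)
      rw [he, integral_add hI (integrable_const _), integral_sub hd2 (hd1.const_mul _),
        integral_const_mul, integral_const, ← hM]
      simp only [probReal_univ, smul_eq_mul, one_mul]
      nlinarith
    rw [integral_eq_zero_iff_of_nonneg (fun _ => sq_nonneg _) hI2] at h0
    filter_upwards [h0] with w hw
    have : dist x w - M = 0 := by simpa using hw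
    linarith
  have hall : ∀ᵐ w ∂μ.1, ∀ k : ℕ, dist (TopologicalSpace.denseSeq X k) w
      = ∫ w, dist (TopologicalSpace.denseSeq X k) w ∂μ.1 :=
    ae_all_iff.2 fun k => hconst _
  obtain ⟨p, hp⟩ := hall.exists
  refine ⟨p, Subtype.ext ?_⟩
  have hae : (fun w => w) =ᵐ[μ.1] fun _ => p := by
    filter_upwards [hall] with w hw
    refine dist_le_zero.1 (le_of_forall_pos_le_add fun ε hε => ?_)
    obtain ⟨k, hk⟩ := (TopologicalSpace.denseRange_denseSeq X).exists_dist_lt p (half_pos hε)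
    have h1 := dist_triangle_left w p (TopologicalSpace.denseSeq X k)
    rw [hw k, ← hp k, dist_comm w p, dist_comm _ p] at h1
    rw [dist_comm w p]
    linarith
  change μ.1 = Measure.dirac p
  calc μ.1 = μ.1.map (fun w => w) := Measure.map_id.symm
    _ = μ.1.map fun _ => p := Measure.map_congr hae
    _ = Measure.dirac p := by rw [Measure.map_const]; simp

/-- An isometry of the Wasserstein space acts on Dirac masses through an isometry of the
underlying space. -/
lemma exists_isometryEquiv_dirac
    (hext : ∀ p y : X, ∃ e : X, dist p e = 2 * dist p y ∧ dist y e = dist p y)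
    (Φ : W2Space X ≃ W2Space X) (hΦ : ∀ μ ν, W2sq (Φ μ) (Φ ν) = W2sq μ ν) :
    ∃ φ : X ≃ᵢ X, ∀ x, Φ (W2Space.dirac x) = W2Space.dirac (φ x) := by
  have hΦs : ∀ μ ν, W2sq (Φ.symm μ) (Φ.symm ν) = W2sq μ ν := fun μ ν => by
    rw [← hΦ, Φ.apply_symm_apply, Φ.apply_symm_apply]
  choose f hf using fun x =>
    eq_dirac_of_approxExtendable ((approxExtendable_dirac hext x).apply Φ hΦ)
  choose g hg using fun x =>
    eq_dirac_of_approxExtendable ((approxExtendable_dirac hext x).apply Φ.symm hΦs)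
  have hinj : ∀ x y : X, W2Space.dirac x = W2Space.dirac y → x = y := by
    intro x y h
    have h1 := W2sq_dirac_dirac x y
    rw [h, W2sq_dirac_dirac y y, dist_self] at h1
    exact dist_eq_zero.1 (pow_eq_zero_iff two_ne_zero |>.1 (by simpa using h1.symm))
  have hiso : Isometry f := Isometry.of_dist_eq fun x y => by
    have h1 := hΦ (W2Space.dirac x) (W2Space.dirac y)
    rw [hf, hf, W2sq_dirac_dirac, W2sq_dirac_dirac] at h1
    exact (sq_eq_sq₀ dist_nonneg dist_nonneg).1 h1
  refine ⟨IsometryEquiv.mk' f g (fun x => hinj _ _ ?_) hiso, hf⟩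
  rw [← hf, ← hg, Φ.apply_symm_apply]

end DiracMasses

/-! ## The distance to the points of a complete geodesic -/

section LineGeometry

variable {X : Type*} [MetricSpace X] {γ : ℝ → X}

lemma isGeodesicOnWith_segment (hγ : ∀ s t, dist (γ s) (γ t) = |s - t|) (a b : ℝ) (S : Set ℝ) :
    IsGeodesicOnWith dist (fun t => γ ((1 - t) * a + t * b)) S (dist (γ a) (γ b)) := by
  intro t _ t' _
  change dist (γ ((1 - t) * a + t * b)) (γ ((1 - t') * a + t' * b)) = _
  rw [hγ, hγ, ← abs_mul, show (1 - t) * a + t * b - ((1 - t') * a + t' * b) = -((a - b) * (t - t'))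
    by ring, abs_neg]

lemma IsHadamard.dist_sq_line_le (hX : IsHadamard X) (hγ : ∀ s t, dist (γ s) (γ t) = |s - t|)
    (w : X) (a b : ℝ) {t : ℝ} (ht : t ∈ Set.Icc (0:ℝ) 1) :
    dist w (γ ((1 - t) * a + t * b)) ^ 2
      ≤ (1 - t) * dist w (γ a) ^ 2 + t * dist w (γ b) ^ 2 - t * (1 - t) * (a - b) ^ 2 := by
  have h := hX.cat0 w (γ a) (γ b) (fun t => γ ((1 - t) * a + t * b)) (by simp) (by simp)
    (isGeodesicOnWith_segment hγ a b _) t ht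
  rwa [hγ a b, sq_abs] at h

lemma IsNegativelyCurved.dist_sq_line_lt (hX : IsNegativelyCurved X)
    (hγ : ∀ s t, dist (γ s) (γ t) = |s - t|) {w : X} {a b : ℝ}
    (hw : ¬ Aligned w (γ a) (γ b)) {t : ℝ} (ht : t ∈ Set.Ioo (0:ℝ) 1) :
    dist w (γ ((1 - t) * a + t * b)) ^ 2
      < (1 - t) * dist w (γ a) ^ 2 + t * dist w (γ b) ^ 2 - t * (1 - t) * (a - b) ^ 2 := by
  have h := hX.2 w (γ a) (γ b) (fun t => γ ((1 - t) * a + t * b)) (by simp) (by simp)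
    (isGeodesicOnWith_segment hγ a b _) hw t ht
  rwa [hγ a b, sq_abs] at h

lemma IsHadamard.mem_range_of_aligned (hX : IsHadamard X)
    (hγ : ∀ s t, dist (γ s) (γ t) = |s - t|) {w : X} {r : ℝ} (hr : dist w (γ 0) < r)
    (hal : Aligned w (γ (-r)) (γ r)) : w ∈ Set.range γ := by
  have hr0 : 0 < r := dist_nonneg.trans_lt hr
  have e1 : dist (γ (-r)) (γ 0) = r := by rw [hγ]; simp [abs_of_pos hr0]
  have e2 : dist (γ r) (γ 0) = r := by rw [hγ]; simp [abs_of_pos hr0]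
  have e3 : dist (γ (-r)) (γ r) = 2 * r := by
    rw [hγ, show -r - r = -(2 * r) by ring, abs_neg, abs_of_pos (by linarith)]
  have t1 := dist_triangle w (γ 0) (γ r)
  have t2 := dist_triangle_left (γ r) (γ 0) w
  have t3 := dist_triangle w (γ 0) (γ (-r))
  have t4 := dist_triangle_left (γ (-r)) (γ 0) w
  rw [e2] at t2
  rw [e1] at t4
  rw [dist_comm (γ 0), e2] at t1
  rw [dist_comm (γ 0), e1] at t3
  rcases hal with h | h | h
  · rw [e3] at h; linarith
  · rw [e3, dist_comm (γ (-r)) w] at h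
    set a := dist w (γ (-r)) with ha
    refine ⟨-r + a, (dist_le_zero.1 ?_).symm⟩
    have ha0 : 0 ≤ a := dist_nonneg
    have hb : dist w (γ r) = 2 * r - a := by linarith
    have hb0 : 0 ≤ 2 * r - a := hb ▸ dist_nonneg
    have hc := hX.dist_sq_line_le hγ w (-r) r (t := a / (2 * r))
      ⟨by positivity, by rw [div_le_one (by linarith)]; linarith⟩
    rw [hb, ← ha, show (1 - a / (2 * r)) * (-r) + a / (2 * r) * r = -r + a by field_simp; ring,
      show (1 - a / (2 * r)) * a ^ 2 + a / (2 * r) * (2 * r - a) ^ 2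
        - a / (2 * r) * (1 - a / (2 * r)) * (-r - r) ^ 2 = 0 by field_simp; ring] at hc
    nlinarith [dist_nonneg (x := w) (y := γ (-r + a))]
  · rw [dist_comm (γ r), e3] at h; linarith

/-- The coordinate of a point along a complete geodesic, expressed through distances to two of its
points. -/
def lineCoord (γ : ℝ → X) (w : X) : ℝ := (dist (γ 0) w ^ 2 - dist (γ 1) w ^ 2 + 1) / 2

lemma lineCoord_apply (hγ : ∀ s t, dist (γ s) (γ t) = |s - t|) (s : ℝ) :
    lineCoord γ (γ s) = s := by
  rw [lineCoord, hγ, hγ, sq_abs, sq_abs]; ring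

lemma apply_lineCoord (hγ : ∀ s t, dist (γ s) (γ t) = |s - t|) {w : X} (hw : w ∈ Set.range γ) :
    γ (lineCoord γ w) = w := by
  obtain ⟨s, rfl⟩ := hw
  rw [lineCoord_apply hγ]

lemma continuous_lineCoord (γ : ℝ → X) : Continuous (lineCoord γ) := by
  unfold lineCoord; fun_prop

lemma continuous_of_unit_speed (hγ : ∀ s t, dist (γ s) (γ t) = |s - t|) : Continuous γ :=
  (Isometry.of_dist_eq fun s t => by rw [hγ, Real.dist_eq]).continuous

/-- The defect from flatness of the squared distance to the points of a complete geodesic has an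
asymptotic slope. -/
lemma exists_tendsto_slope (hγ : ∀ s t, dist (γ s) (γ t) = |s - t|) (z : X) :
    ∃ P : ℝ, Tendsto (fun s : ℝ => (dist z (γ s) ^ 2 - s ^ 2) / s) atTop (𝓝 P) := by
  have hanti : Antitone fun s => dist z (γ s) - s := by
    intro s t hst
    have := dist_triangle z (γ s) (γ t)
    rw [hγ, abs_sub_comm, abs_of_nonneg (sub_nonneg.2 hst)] at this
    change dist z (γ t) - t ≤ dist z (γ s) - s
    linarith
  have hbdd : BddBelow (Set.range fun s => dist z (γ s) - s) := by
    refine ⟨-dist z (γ 0), ?_⟩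
    rintro _ ⟨s, rfl⟩
    have := dist_triangle_left (γ 0) (γ s) z
    rw [hγ] at this
    have h2 := neg_abs_le (0 - s)
    change -dist z (γ 0) ≤ dist z (γ s) - s
    linarith
  have hb := tendsto_atTop_ciInf hanti hbdd
  set b := ⨅ s, (dist z (γ s) - s)
  refine ⟨b * (2 + b * 0), ?_⟩
  refine (hb.mul (tendsto_const_nhds.add (hb.mul tendsto_inv_atTop_zero))).congr' ?_
  filter_upwards [eventually_gt_atTop 0] with s hs
  field_simp
  ring

/-- The two asymptotic slopes do not add up to zero for a point outside the geodesic. -/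
lemma exists_slopes (hX : IsHadamard X) (hneg : IsNegativelyCurved X)
    (hγ : ∀ s t, dist (γ s) (γ t) = |s - t|) {z : X} (hz : z ∉ Set.range γ) :
    ∃ P Q : ℝ, 0 < P + Q ∧ ∀ u : ℝ, Tendsto (fun n : ℕ =>
      (dist z (γ (((n:ℝ) + 1) * u)) ^ 2 - (((n:ℝ) + 1) * u) ^ 2) / ((n:ℝ) + 1)) atTop
        (𝓝 ((P + Q) * max u 0 - Q * u)) := by
  obtain ⟨P, hP⟩ := exists_tendsto_slope hγ z
  obtain ⟨Q, hQ⟩ := exists_tendsto_slope (γ := fun s => γ (-s))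
    (fun s t => by rw [hγ, abs_sub_comm]; congr 1; ring) z
  have hn : Tendsto (fun n : ℕ => (n:ℝ) + 1) atTop atTop :=
    tendsto_atTop_add_const_right _ _ tendsto_natCast_atTop_atTop
  refine ⟨P, Q, ?_, fun u => ?_⟩
  · obtain ⟨r, hr⟩ := exists_gt (dist z (γ 0))
    have hr0 : 0 < r := dist_nonneg.trans_lt hr
    have hstrict := hneg.dist_sq_line_lt hγ
      (fun h => hz (hX.mem_range_of_aligned hγ hr h)) (t := 1 / 2) ⟨by norm_num, by norm_num⟩
    rw [show (1 - 1 / 2 : ℝ) * -r + 1 / 2 * r = 0 by ring] at hstrict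
    set K : ℝ → ℝ := fun s => dist z (γ s) ^ 2 - s ^ 2 with hK
    have hη : 0 < K r + K (-r) - 2 * K 0 := by
      simp only [hK]
      nlinarith
    have hconv : ∀ s : ℝ, r ≤ s →
        (K r + K (-r) - 2 * K 0) / r + 2 * K 0 * s⁻¹ ≤ (dist z (γ s) ^ 2 - s ^ 2) / s
          + (dist z (γ (-s)) ^ 2 - s ^ 2) / s := by
      intro s hs
      have hs0 : 0 < s := hr0.trans_le hs
      have ht : r / s ∈ Set.Icc (0:ℝ) 1 := ⟨by positivity, (div_le_one hs0).2 hs⟩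
      have h1 := hX.dist_sq_line_le hγ z 0 s ht
      have h2 := hX.dist_sq_line_le hγ z 0 (-s) ht
      rw [show (1 - r / s) * 0 + r / s * s = r by field_simp; ring] at h1
      rw [show (1 - r / s) * 0 + r / s * -s = -r by field_simp; ring] at h2
      have h1' : K r ≤ (1 - r / s) * K 0 + r / s * K s := by
        have : r / s * (1 - r / s) * (0 - s) ^ 2 = r * s - r ^ 2 := by field_simp; ring
        have h3 : r / s * s ^ 2 = r * s := by field_simp
        simp only [hK]
        nlinarith
      have h2' : K (-r) ≤ (1 - r / s) * K 0 + r / s * K (-s) := by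
        have : r / s * (1 - r / s) * (0 - -s) ^ 2 = r * s - r ^ 2 := by field_simp; ring
        have h3 : r / s * s ^ 2 = r * s := by field_simp
        simp only [hK]
        nlinarith
      have h3 : (K r + K (-r) - 2 * K 0) / r ≤ (r / s * (K s + K (-s) - 2 * K 0)) / r := by
        gcongr
        linarith
      have h4 : (r / s * (K s + K (-s) - 2 * K 0)) / r + 2 * K 0 * s⁻¹
          = (dist z (γ s) ^ 2 - s ^ 2) / s + (dist z (γ (-s)) ^ 2 - s ^ 2) / s := by
        simp only [hK]
        field_simp
        ring
      linarith
    have hlim : Tendsto (fun s : ℝ => (K r + K (-r) - 2 * K 0) / r + 2 * K 0 * s⁻¹) atTop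
        (𝓝 ((K r + K (-r) - 2 * K 0) / r + 2 * K 0 * 0)) :=
      tendsto_const_nhds.add (tendsto_const_nhds.mul tendsto_inv_atTop_zero)
    have hle := le_of_tendsto_of_tendsto hlim (hP.add hQ)
      ((eventually_ge_atTop r).mono hconv)
    rw [mul_zero, add_zero] at hle
    exact (div_pos hη hr0).trans_le hle
  · rcases lt_trichotomy u 0 with hu | rfl | hu
    · have h1 := (hQ.comp (hn.atTop_mul_const (neg_pos.2 hu))).mul_const (-u)
      rw [max_eq_right hu.le, show (P + Q) * 0 - Q * u = Q * -u by ring]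
      refine h1.congr fun n => ?_
      have : (n:ℝ) + 1 ≠ 0 := by positivity
      have hu' := hu.ne
      simp only [Function.comp, show -(((n:ℝ) + 1) * -u) = ((n:ℝ) + 1) * u by ring]
      field_simp
    · simp only [mul_zero, max_self, sub_zero]
      have h1 := hn.inv_tendsto_atTop.const_mul (dist z (γ 0) ^ 2)
      rw [mul_zero] at h1
      refine h1.congr fun n => ?_
      simp [div_eq_mul_inv]
    · have h1 := (hP.comp (hn.atTop_mul_const hu)).mul_const u
      rw [max_eq_left hu.le, show (P + Q) * u - Q * u = P * u by ring]
      refine h1.congr fun n => ?_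
      have : (n:ℝ) + 1 ≠ 0 := by positivity
      have hu' := hu.ne'
      simp only [Function.comp]
      field_simp

end LineGeometry

/-! ## Measures supported on a complete geodesic -/

section LineMeasures

variable {X : Type*} [MetricSpace X] [MeasurableSpace X] [BorelSpace X] {γ : ℝ → X}

lemma W2Space.integrable_lineCoord (μ : W2Space X) (γ : ℝ → X) :
    Integrable (lineCoord γ) μ.1 :=
  (((μ.integrable_dist_sq (γ 0)).sub (μ.integrable_dist_sq (γ 1))).add
    (integrable_const 1)).div_const 2

lemma integral_lineCoord_eq {μ ν : W2Space X}
    (h : ∀ x, ∫ w, dist x w ^ 2 ∂ν.1 = ∫ w, dist x w ^ 2 ∂μ.1) (γ : ℝ → X) :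
    ∫ w, lineCoord γ w ∂ν.1 = ∫ w, lineCoord γ w ∂μ.1 := by
  have key : ∀ m : W2Space X, ∫ w, lineCoord γ w ∂m.1
      = (∫ w, dist (γ 0) w ^ 2 ∂m.1 - ∫ w, dist (γ 1) w ^ 2 ∂m.1 + 1) / 2 := by
    intro m
    have h0 := m.integrable_dist_sq (γ 0)
    have h1 := m.integrable_dist_sq (γ 1)
    have e1 := integral_add (h0.sub h1) (integrable_const (1:ℝ))
    have e2 := integral_sub h0 h1
    simp only [Pi.sub_apply, integral_const, probReal_univ, one_smul] at e1 e2
    simp only [lineCoord]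
    rw [integral_div, e1, e2]
  rw [key, key, h, h]

/-- Being supported on a complete geodesic is detected by the second moments. -/
lemma ae_mem_range_of_integral_dist_sq_eq (hX : IsHadamard X) (hneg : IsNegativelyCurved X)
    (hγ : ∀ s t, dist (γ s) (γ t) = |s - t|) {μ ν : W2Space X}
    (h : ∀ x, ∫ w, dist x w ^ 2 ∂ν.1 = ∫ w, dist x w ^ 2 ∂μ.1)
    (hμ : ∀ᵐ w ∂μ.1, w ∈ Set.range γ) : ∀ᵐ w ∂ν.1, w ∈ Set.range γ := by
  have hal : ∀ n : ℕ, ∀ᵐ w ∂ν.1, Aligned w (γ (-n)) (γ n) := by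
    intro n
    set G : X → ℝ := fun w => 1 / 2 * dist (γ (-n)) w ^ 2 + 1 / 2 * dist (γ n) w ^ 2
      - dist (γ 0) w ^ 2 - (n:ℝ) ^ 2 with hG
    have hGi : ∀ m : W2Space X, Integrable G m.1 := fun m =>
      ((((m.integrable_dist_sq _).const_mul _).add ((m.integrable_dist_sq _).const_mul _)).sub
        (m.integrable_dist_sq _)).sub (integrable_const _)
    have hGint : ∀ m : W2Space X, ∫ w, G w ∂m.1 = 1 / 2 * ∫ w, dist (γ (-n)) w ^ 2 ∂m.1
        + 1 / 2 * ∫ w, dist (γ n) w ^ 2 ∂m.1 - ∫ w, dist (γ 0) w ^ 2 ∂m.1 - (n:ℝ) ^ 2 := by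
      intro m
      have h1 := (m.integrable_dist_sq (γ (-n))).const_mul (1 / 2)
      have h2 := (m.integrable_dist_sq (γ n)).const_mul (1 / 2)
      have h3 := m.integrable_dist_sq (γ 0)
      have e1 := integral_sub ((h1.add h2).sub h3) (integrable_const ((n:ℝ) ^ 2))
      have e2 := integral_sub (h1.add h2) h3
      have e3 := integral_add h1 h2
      simp only [Pi.add_apply, Pi.sub_apply, integral_const, probReal_univ, one_smul] at e1 e2 e3
      simp only [hG]
      rw [e1, e2, e3, integral_const_mul, integral_const_mul]
    have hmid : (1 - 1 / 2 : ℝ) * -(n:ℝ) + 1 / 2 * n = 0 := by ring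
    have hG0 : ∀ w, 0 ≤ G w := by
      intro w
      have := hX.dist_sq_line_le hγ w (-n) n (t := 1 / 2) ⟨by norm_num, by norm_num⟩
      rw [hmid] at this
      simp only [hG, dist_comm _ w]
      linarith
    have hGμ : ∫ w, G w ∂μ.1 = 0 := by
      refine integral_eq_zero_of_ae ?_
      filter_upwards [hμ] with w hw
      obtain ⟨s, rfl⟩ := hw
      simp only [hG, hγ, sq_abs, Pi.zero_apply]
      ring
    have hGν : ∫ w, G w ∂ν.1 = 0 := by
      rw [hGint, h, h, h, ← hGint, hGμ]
    filter_upwards [(integral_eq_zero_iff_of_nonneg hG0 (hGi ν)).1 hGν] with w hw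
    by_contra hcon
    have := hneg.dist_sq_line_lt hγ hcon (t := 1 / 2) ⟨by norm_num, by norm_num⟩
    rw [hmid] at this
    simp only [hG, dist_comm _ w, Pi.zero_apply] at hw
    linarith
  filter_upwards [ae_all_iff.2 hal] with w hw
  obtain ⟨n, hn⟩ := exists_nat_gt (dist w (γ 0))
  exact hX.mem_range_of_aligned hγ hn (hw n)

/-- The rescaled moments of a measure on a complete geodesic converge. -/
lemma tendsto_integral_slope (hγ : ∀ s t, dist (γ s) (γ t) = |s - t|) {z : X} {P Q : ℝ}
    (hPQ : ∀ u : ℝ, Tendsto (fun n : ℕ =>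
      (dist z (γ (((n:ℝ) + 1) * u)) ^ 2 - (((n:ℝ) + 1) * u) ^ 2) / ((n:ℝ) + 1)) atTop
        (𝓝 ((P + Q) * max u 0 - Q * u))) (μ : W2Space X) :
    Tendsto (fun n : ℕ => ∫ w, (dist z (γ (((n:ℝ) + 1) * lineCoord γ w)) ^ 2
      - (((n:ℝ) + 1) * lineCoord γ w) ^ 2) / ((n:ℝ) + 1) ∂μ.1) atTop
        (𝓝 ((P + Q) * ∫ w, max (lineCoord γ w) 0 ∂μ.1 - Q * ∫ w, lineCoord γ w ∂μ.1)) := by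
  have hγc := continuous_of_unit_speed hγ
  have hσc := continuous_lineCoord γ
  have hi := μ.integrable_lineCoord γ
  have e := integral_sub (hi.pos_part.const_mul (P + Q)) (hi.const_mul Q)
  rw [integral_const_mul, integral_const_mul] at e
  rw [← e]
  set C := dist z (γ 0)
  refine tendsto_integral_of_dominated_convergence
    (fun w => C ^ 2 + 2 * C * |lineCoord γ w|) (fun n => ?_)
    ((integrable_const _).add (hi.abs.const_mul _)) (fun n => ae_of_all _ fun w => ?_)
    (ae_of_all _ fun w => hPQ _)
  · exact Continuous.aestronglyMeasurable (by fun_prop)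
  · set u := lineCoord γ w
    have hn : (1:ℝ) ≤ (n:ℝ) + 1 := by linarith [n.cast_nonneg (α := ℝ)]
    have hn0 : (0:ℝ) < (n:ℝ) + 1 := by linarith
    set d := dist z (γ (((n:ℝ) + 1) * u)) with hd
    have hv : |((n:ℝ) + 1) * u| = ((n:ℝ) + 1) * |u| := by rw [abs_mul, abs_of_pos hn0]
    have t1 := dist_triangle z (γ 0) (γ (((n:ℝ) + 1) * u))
    have t2 := dist_triangle_left (γ 0) (γ (((n:ℝ) + 1) * u)) z
    rw [hγ, zero_sub, abs_neg, hv] at t1 t2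
    have hu := abs_nonneg u
    have hC : 0 ≤ C := dist_nonneg
    have hd0 : 0 ≤ d := dist_nonneg
    set v := ((n:ℝ) + 1) * |u|
    have hv0 : 0 ≤ v := by positivity
    rw [Real.norm_eq_abs, abs_div, abs_of_pos hn0, div_le_iff₀ hn0, ← sq_abs (((n:ℝ) + 1) * u),
      hv, show (C ^ 2 + 2 * C * |u|) * ((n:ℝ) + 1) = C ^ 2 * ((n:ℝ) + 1) + 2 * C * v by ring]
    have h1 : C ^ 2 ≤ C ^ 2 * ((n:ℝ) + 1) := le_mul_of_one_le_right (sq_nonneg _) hn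
    change |d ^ 2 - v ^ 2| ≤ _
    change d ≤ C + v at t1
    change v ≤ C + d at t2
    rw [abs_le]
    constructor <;> nlinarith

variable [SecondCountableTopology X]

/-- A measure at the distance from `ν` of a dilation, and with the same second moment, is a
dilation of `ν`. -/
lemma map_lineCoord_eq_of_dilation (hγ : ∀ s t, dist (γ s) (γ t) = |s - t|)
    {μ ν μ' ν' : W2Space X} (hμ : ∀ᵐ w ∂μ.1, w ∈ Set.range γ)
    (hν : ∀ᵐ w ∂ν.1, w ∈ Set.range γ) (hν' : ∀ᵐ w ∂ν'.1, w ∈ Set.range γ)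
    {c : ℝ} (hc : 1 ≤ c) (hμ' : μ'.1 = μ.1.map fun w => γ (c * lineCoord γ w))
    (h : ∫ w, dist (γ 0) w ^ 2 ∂ν.1 = ∫ w, dist (γ 0) w ^ 2 ∂μ.1)
    (h' : ∫ w, dist (γ 0) w ^ 2 ∂ν'.1 = ∫ w, dist (γ 0) w ^ 2 ∂μ'.1)
    (hW : W2sq ν ν' = W2sq μ μ') :
    ν.1.map (fun w => c * lineCoord γ w) = ν'.1.map (lineCoord γ) := by
  have hγm : Measurable γ := (continuous_of_unit_speed hγ).measurable
  have hσm : Measurable (lineCoord γ) := (continuous_lineCoord γ).measurable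
  have hcσm : Measurable fun w => c * lineCoord γ w := hσm.const_mul c
  have hT : Measurable fun w => γ (c * lineCoord γ w) := hγm.comp hcσm
  have := Measure.isProbabilityMeasure_map (μ := ν.1) hcσm.aemeasurable
  have := Measure.isProbabilityMeasure_map (μ := ν'.1) hσm.aemeasurable
  set R := ∫ w, dist (γ 0) w ^ 2 ∂μ.1 with hR
  have hR' : ∫ w, dist (γ 0) w ^ 2 ∂μ'.1 = c ^ 2 * R := by
    rw [hμ', integral_map hT.aemeasurable (by fun_prop), hR, ← integral_const_mul]
    refine integral_congr_ae ?_
    filter_upwards [hμ] with w hw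
    obtain ⟨s, rfl⟩ := hw
    rw [lineCoord_apply hγ, hγ, hγ, sq_abs, sq_abs]
    ring
  have hup : W2sq μ μ' ≤ (c - 1) ^ 2 * R := by
    refine (W2sq_le_of_map μ μ' hT hμ'.symm).trans_eq ?_
    rw [hR, ← integral_const_mul]
    refine integral_congr_ae ?_
    filter_upwards [hμ] with w hw
    obtain ⟨s, rfl⟩ := hw
    rw [lineCoord_apply hγ, hγ, hγ, sq_abs, sq_abs]
    ring
  have hc0 : 0 < c := by linarith
  refine measure_eq_of_forall_coupling fun ε hε => ?_
  obtain ⟨π, hπ, hlt⟩ := exists_coupling_lt ν ν' (c := (c - 1) ^ 2 * R + ε / c)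
    (by rw [hW]; have : 0 < ε / c := by positivity
        linarith)
  have hS : Measurable fun q : X × X => (c * lineCoord γ q.1, lineCoord γ q.2) :=
    (hcσm.comp measurable_fst).prodMk (hσm.comp measurable_snd)
  have i1 := hπ.integrable_dist_sq.const_mul c
  have i2 := (hπ.integrable_snd (ν'.integrable_dist_sq (γ 0))).const_mul (1 - c)
  have i3 := (hπ.integrable_fst (ν.integrable_dist_sq (γ 0))).const_mul (c ^ 2 - c)
  have hae : (fun q : X × X => c * dist q.1 q.2 ^ 2 + (1 - c) * dist (γ 0) q.2 ^ 2
      + (c ^ 2 - c) * dist (γ 0) q.1 ^ 2) =ᵐ[π]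
      fun q => dist (c * lineCoord γ q.1) (lineCoord γ q.2) ^ 2 := by
    filter_upwards [hπ.ae_fst hν, hπ.ae_snd hν'] with q hq1 hq2
    obtain ⟨a, ha⟩ := hq1
    obtain ⟨b, hb⟩ := hq2
    rw [← ha, ← hb, lineCoord_apply hγ, lineCoord_apply hγ, hγ, hγ, hγ, Real.dist_eq]
    simp only [sq_abs]
    ring
  refine ⟨π.map fun q => (c * lineCoord γ q.1, lineCoord γ q.2), ⟨?_, ?_⟩, ?_, ?_⟩
  · rw [Measure.map_map measurable_fst hS, ← hπ.1, Measure.map_map hcσm measurable_fst]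
    rfl
  · rw [Measure.map_map measurable_snd hS, ← hπ.2, Measure.map_map hσm measurable_snd]
    rfl
  · rw [integrable_map_measure (by fun_prop) hS.aemeasurable]
    exact ((i1.add i2).add i3).congr hae
  · rw [integral_map hS.aemeasurable (by fun_prop)]
    have e1 := integral_add (i1.add i2) i3
    have e2 := integral_add i1 i2
    simp only [Pi.add_apply] at e1 e2
    rw [← integral_congr_ae hae, e1, e2, integral_const_mul, integral_const_mul,
      integral_const_mul, hπ.integral_fst (f := fun w => dist (γ 0) w ^ 2) (by fun_prop),
      hπ.integral_snd (f := fun w => dist (γ 0) w ^ 2) (by fun_prop), h, h', hR']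
    have h4 := mul_lt_mul_of_pos_left hlt hc0
    have h5 : c * (ε / c) = ε := by field_simp
    nlinarith

variable {Ψ : W2Space X → W2Space X}

lemma integral_dist_sq_eq_of_dirac (hΨ : ∀ μ ν, W2sq (Ψ μ) (Ψ ν) = W2sq μ ν)
    (hd : ∀ x, Ψ (W2Space.dirac x) = W2Space.dirac x) (μ : W2Space X) (x : X) :
    ∫ w, dist x w ^ 2 ∂(Ψ μ).1 = ∫ w, dist x w ^ 2 ∂μ.1 := by
  rw [← W2sq_dirac, ← W2sq_dirac, ← hΨ μ, hd]

lemma integral_posPart_lineCoord_eq (hX : IsHadamard X) (hneg : IsNegativelyCurved X)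
    (hΨ : ∀ μ ν, W2sq (Ψ μ) (Ψ ν) = W2sq μ ν)
    (hd : ∀ x, Ψ (W2Space.dirac x) = W2Space.dirac x)
    (hγ : ∀ s t, dist (γ s) (γ t) = |s - t|) {μ : W2Space X}
    (hμ : ∀ᵐ w ∂μ.1, w ∈ Set.range γ) :
    ∫ w, max (lineCoord γ w) 0 ∂(Ψ μ).1 = ∫ w, max (lineCoord γ w) 0 ∂μ.1 := by
  have hsame := integral_dist_sq_eq_of_dirac hΨ hd
  obtain ⟨z, hz⟩ : ∃ z, z ∉ Set.range γ := by
    by_contra! hall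
    exact hneg.1 ⟨γ, hall, hγ⟩
  have hγc := continuous_of_unit_speed hγ
  have hσc := continuous_lineCoord γ
  obtain ⟨P, Q, hPQ0, hPQ⟩ := exists_slopes hX hneg hγ hz
  have hmom : ∀ n : ℕ, ∫ w, (dist z (γ (((n:ℝ) + 1) * lineCoord γ w)) ^ 2
      - (((n:ℝ) + 1) * lineCoord γ w) ^ 2) / ((n:ℝ) + 1) ∂(Ψ μ).1
      = ∫ w, (dist z (γ (((n:ℝ) + 1) * lineCoord γ w)) ^ 2
      - (((n:ℝ) + 1) * lineCoord γ w) ^ 2) / ((n:ℝ) + 1) ∂μ.1 := by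
    intro n
    rw [integral_div, integral_div]
    congr 1
    set c := (n:ℝ) + 1
    have hT : Continuous fun w => γ (c * lineCoord γ w) := by fun_prop
    have hcσ : Continuous fun w => c * lineCoord γ w := by fun_prop
    have hint : Integrable (fun w => dist (γ 0) (γ (c * lineCoord γ w)) ^ 2) μ.1 := by
      refine ((μ.integrable_dist_sq (γ 0)).const_mul (c ^ 2)).congr ?_
      filter_upwards [hμ] with w hw
      obtain ⟨s, rfl⟩ := hw
      rw [lineCoord_apply hγ, hγ, hγ, sq_abs, sq_abs]
      ring
    set μ' := μ.map (fun w => γ (c * lineCoord γ w)) hT.measurable (γ 0) hint with hμ'def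
    have hμ'1 : μ'.1 = μ.1.map fun w => γ (c * lineCoord γ w) := rfl
    have hμ' : ∀ᵐ w ∂μ'.1, w ∈ Set.range γ := by
      have hcl : IsClosed (Set.range γ) :=
        (Isometry.of_dist_eq fun s t => by
          rw [hγ, Real.dist_eq] : Isometry γ).isClosedEmbedding.isClosed_range
      rw [hμ'1]
      exact (ae_map_iff hT.aemeasurable hcl.measurableSet).2
        (ae_of_all _ fun w => Set.mem_range_self _)
    have hν := ae_mem_range_of_integral_dist_sq_eq hX hneg hγ (hsame μ) hμ
    have hν' := ae_mem_range_of_integral_dist_sq_eq hX hneg hγ (hsame μ') hμ'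
    have hdil := map_lineCoord_eq_of_dilation hγ hμ hν hν'
      (c := c) (by simp only [c]; linarith [n.cast_nonneg (α := ℝ)]) hμ'1 (hsame μ _)
      (hsame μ' _) (hΨ μ μ')
    have hK : Continuous fun u : ℝ => dist z (γ u) ^ 2 - u ^ 2 := by fun_prop
    have hsub : ∀ m : W2Space X, (∀ᵐ w ∂m.1, w ∈ Set.range γ) →
        ∫ w, (dist z (γ (lineCoord γ w)) ^ 2 - lineCoord γ w ^ 2) ∂m.1
          = ∫ w, dist z w ^ 2 ∂m.1 - ∫ w, dist (γ 0) w ^ 2 ∂m.1 := by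
      intro m hm
      rw [← integral_sub (m.integrable_dist_sq z) (m.integrable_dist_sq (γ 0))]
      refine integral_congr_ae ?_
      filter_upwards [hm] with w hw
      obtain ⟨s, rfl⟩ := hw
      rw [lineCoord_apply hγ, hγ, sq_abs, zero_sub, neg_sq]
    calc ∫ w, (dist z (γ (c * lineCoord γ w)) ^ 2 - (c * lineCoord γ w) ^ 2) ∂(Ψ μ).1
        = ∫ u, (dist z (γ u) ^ 2 - u ^ 2) ∂((Ψ μ).1.map fun w => c * lineCoord γ w) :=
          (integral_map hcσ.aemeasurable hK.aestronglyMeasurable).symm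
      _ = ∫ w, (dist z (γ (lineCoord γ w)) ^ 2 - lineCoord γ w ^ 2) ∂(Ψ μ').1 := by
          rw [hdil]
          exact integral_map hσc.aemeasurable hK.aestronglyMeasurable
      _ = ∫ w, (dist z (γ (lineCoord γ w)) ^ 2 - lineCoord γ w ^ 2) ∂μ'.1 := by
          rw [hsub _ hν', hsub _ hμ', hsame, hsame]
      _ = ∫ w, (dist z (γ (c * lineCoord γ w)) ^ 2 - (c * lineCoord γ w) ^ 2) ∂μ.1 := by
          rw [hμ'1, integral_map hT.aemeasurable
            (Continuous.aestronglyMeasurable (by fun_prop))]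
          simp only [lineCoord_apply hγ]
  have h1 := tendsto_integral_slope hγ hPQ (Ψ μ)
  have h2 := tendsto_integral_slope hγ hPQ μ
  simp only [hmom] at h1
  have h3 := tendsto_nhds_unique h1 h2
  rw [integral_lineCoord_eq (hsame μ)] at h3
  exact mul_left_cancel₀ hPQ0.ne' (by linarith)

/-- An isometry fixing the Dirac masses fixes the measures supported on a complete geodesic. -/
lemma fixes_of_ae_mem_range (hX : IsHadamard X) (hneg : IsNegativelyCurved X)
    (hΨ : ∀ μ ν, W2sq (Ψ μ) (Ψ ν) = W2sq μ ν)
    (hd : ∀ x, Ψ (W2Space.dirac x) = W2Space.dirac x)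
    (hγ : ∀ s t, dist (γ s) (γ t) = |s - t|) {μ : W2Space X}
    (hμ : ∀ᵐ w ∂μ.1, w ∈ Set.range γ) : Ψ μ = μ := by
  have hsame := integral_dist_sq_eq_of_dirac hΨ hd
  have hν := ae_mem_range_of_integral_dist_sq_eq hX hneg hγ (hsame μ) hμ
  have hγc := continuous_of_unit_speed hγ
  have hσc := continuous_lineCoord γ
  have hi : ∀ m : W2Space X, Integrable (fun s : ℝ => s) (m.1.map (lineCoord γ)) := fun m =>
    (integrable_map_measure (by fun_prop) hσc.aemeasurable).2 (m.integrable_lineCoord γ)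
  have := Measure.isProbabilityMeasure_map (μ := (Ψ μ).1) hσc.aemeasurable
  have := Measure.isProbabilityMeasure_map (μ := μ.1) hσc.aemeasurable
  have hmap : (Ψ μ).1.map (lineCoord γ) = μ.1.map (lineCoord γ) := by
    refine measure_eq_of_forall_integral_posPart (hi _) (hi _) fun c => ?_
    have hγ' : ∀ s t, dist (γ (s + c)) (γ (t + c)) = |s - t| := fun s t => by
      rw [hγ, add_sub_add_right_eq_sub]
    have hrange : ∀ w, w ∈ Set.range γ → w ∈ Set.range fun s => γ (s + c) := by
      rintro _ ⟨s, rfl⟩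
      exact ⟨s - c, by simp⟩
    have hshift : ∀ m : W2Space X, (∀ᵐ w ∂m.1, w ∈ Set.range γ) →
        ∫ s, max (s - c) 0 ∂(m.1.map (lineCoord γ))
          = ∫ w, max (lineCoord (fun s => γ (s + c)) w) 0 ∂m.1 := by
      intro m hm
      rw [integral_map hσc.aemeasurable (by fun_prop)]
      refine integral_congr_ae ?_
      filter_upwards [hm] with w hw
      obtain ⟨s, hs⟩ := hrange w hw
      have e1 := lineCoord_apply hγ' s
      have e2 := lineCoord_apply hγ (s + c)
      simp only at hs
      rw [hs] at e1
      rw [hs] at e2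
      rw [e1, e2, add_sub_cancel_right]
    rw [hshift _ hν, hshift _ hμ]
    exact integral_posPart_lineCoord_eq hX hneg hΨ hd hγ' (hμ.mono hrange)
  have hback : ∀ m : W2Space X, (∀ᵐ w ∂m.1, w ∈ Set.range γ) →
      (m.1.map (lineCoord γ)).map γ = m.1 := by
    intro m hm
    rw [Measure.map_map hγc.measurable hσc.measurable]
    conv_rhs => rw [← Measure.map_id (μ := m.1)]
    refine Measure.map_congr ?_
    filter_upwards [hm] with w hw using apply_lineCoord hγ hw
  exact Subtype.ext (by rw [← hback _ hν, hmap, hback _ hμ])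

end LineMeasures

/-! ## Measures supported on two points -/

section Rigidity

variable {X : Type*} [MetricSpace X]

lemma exists_line_through (hX : IsHadamard X) (hgc : GeodesicallyComplete X) {x y : X}
    (hxy : x ≠ y) : ∃ γ : ℝ → X, (∀ s t, dist (γ s) (γ t) = |s - t|) ∧ γ 0 = x ∧
      γ (dist x y) = y := by
  obtain ⟨c, hc0, hc1, hc⟩ := hX.geodesic x y
  obtain ⟨g, hg, hgeq⟩ := hgc c 0 1 (dist x y) one_pos hc
  have hv : 0 < dist x y := dist_pos.2 hxy
  refine ⟨fun s => g (s / dist x y), fun s t => ?_, ?_, ?_⟩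
  · rw [hg _ (Set.mem_univ _) _ (Set.mem_univ _), ← sub_div, abs_div, abs_of_pos hv]
    field_simp
  · simp only [zero_div]
    rw [hgeq 0 ⟨le_rfl, zero_le_one⟩, hc0]
  · simp only [div_self hv.ne']
    rw [hgeq 1 ⟨zero_le_one, le_rfl⟩, hc1]

lemma exists_extension (hX : IsHadamard X) (hgc : GeodesicallyComplete X) (p y : X) :
    ∃ e : X, dist p e = 2 * dist p y ∧ dist y e = dist p y := by
  rcases eq_or_ne p y with rfl | hpy
  · exact ⟨p, by simp⟩
  · obtain ⟨γ, hγ, h0, h1⟩ := exists_line_through hX hgc hpy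
    refine ⟨γ (2 * dist p y), ?_, ?_⟩
    · nth_rewrite 1 [← h0]
      rw [hγ, zero_sub, abs_neg, abs_of_nonneg (by positivity)]
    · nth_rewrite 1 [← h1]
      rw [hγ, show dist p y - 2 * dist p y = -dist p y by ring, abs_neg,
        abs_of_nonneg dist_nonneg]

/-- The set of points seeing the segment from `x` to `y` under a right angle at `x`, in the
Pythagorean sense. -/
def rightAngleSet (x y : X) : Set X := {z | dist x z ^ 2 - dist y z ^ 2 = -dist x y ^ 2}

lemma self_mem_rightAngleSet (x y : X) : x ∈ rightAngleSet x y := by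
  simp [rightAngleSet, dist_comm y x]

lemma IsNegativelyCurved.eq_of_mem_rightAngleSet (hneg : IsNegativelyCurved X) {γ : ℝ → X}
    (hγ : ∀ s t, dist (γ s) (γ t) = |s - t|) {a b : ℝ} (ha : 0 < a) (hab : a < b) {z : X}
    (hza : z ∈ rightAngleSet (γ 0) (γ a)) (hzb : z ∈ rightAngleSet (γ 0) (γ b)) :
    z = γ 0 := by
  have hb : 0 < b := ha.trans hab
  simp only [rightAngleSet, Set.mem_ofPred_eq, hγ, sq_abs, zero_sub, neg_sq,
    dist_comm _ z] at hza hzb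
  have hal : Aligned z (γ 0) (γ b) := by
    by_contra hcon
    have h := hneg.dist_sq_line_lt hγ hcon (t := a / b)
      ⟨by positivity, (div_lt_one hb).2 hab⟩
    rw [show (1 - a / b) * 0 + a / b * b = a by field_simp; ring] at h
    have e : (1 - a / b) * dist z (γ 0) ^ 2 + a / b * dist z (γ b) ^ 2
        - a / b * (1 - a / b) * (0 - b) ^ 2 = dist z (γ 0) ^ 2 + a ^ 2 := by
      rw [show dist z (γ b) ^ 2 = dist z (γ 0) ^ 2 + b ^ 2 by linarith]
      field_simp
      ring
    linarith
  have hd : dist (γ 0) (γ b) = b := by rw [hγ, zero_sub, abs_neg, abs_of_pos hb]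
  have hzero : dist z (γ 0) * b = 0 := by
    rcases hal with h | h | h
    · rw [hd] at h; rw [← h] at hzb; linarith
    · rw [hd, dist_comm (γ 0) z] at h
      rw [show dist z (γ b) = b - dist z (γ 0) by linarith] at hzb
      linarith
    · rw [dist_comm (γ b), hd] at h
      rw [show dist z (γ b) = dist z (γ 0) - b by linarith] at hzb
      linarith
  exact dist_eq_zero.1 ((mul_eq_zero.1 hzero).resolve_right hb.ne')

variable [MeasurableSpace X] [BorelSpace X]

lemma measurableSet_rightAngleSet (x y : X) : MeasurableSet (rightAngleSet x y) :=
  (isClosed_eq (by fun_prop) continuous_const).measurableSet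

variable [SecondCountableTopology X]

/-- The optimal penalized cost of transport to a measure supported on two points. -/
lemma integral_min_le_W2sq_add {x y : X} (hxy : x ≠ y) (t : ℝ) (μ η : W2Space X)
    (hη : ∀ᵐ w ∂η.1, w = x ∨ w = y) :
    ∫ w, min (dist x w ^ 2) (dist y w ^ 2 + t) ∂μ.1
      ≤ W2sq μ η + ∫ w, ({y} : Set X).indicator (fun _ => t) w ∂η.1 := by
  have hm : Measurable (({y} : Set X).indicator fun _ => t) :=
    measurable_const.indicator (measurableSet_singleton y)
  have hi : Integrable (({y} : Set X).indicator fun _ => t) η.1 :=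
    (integrable_const t).indicator (measurableSet_singleton y)
  rw [← sub_le_iff_le_add]
  refine le_W2sq _ _ fun π hπ => ?_
  rw [sub_le_iff_le_add, ← hπ.integral_snd hm,
    ← hπ.integral_fst (f := fun w => min (dist x w ^ 2) (dist y w ^ 2 + t)) (by fun_prop),
    ← integral_add hπ.integrable_dist_sq (hπ.integrable_snd hi)]
  refine integral_mono_ae (hπ.integrable_fst ((μ.integrable_dist_sq x).inf
    ((μ.integrable_dist_sq y).add (integrable_const t))))
    (hπ.integrable_dist_sq.add (hπ.integrable_snd hi)) ?_
  filter_upwards [hπ.ae_snd hη] with q hq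
  rcases hq with hq | hq
  · simp [hq, hxy, dist_comm q.1]
  · simp [hq, dist_comm q.1]

lemma exists_W2sq_add_le {x y : X} (hxy : x ≠ y) (t : ℝ) (μ : W2Space X) :
    ∃ η : W2Space X, (∀ᵐ w ∂η.1, w = x ∨ w = y) ∧
      W2sq μ η + ∫ w, ({y} : Set X).indicator (fun _ => t) w ∂η.1
        ≤ ∫ w, min (dist x w ^ 2) (dist y w ^ 2 + t) ∂μ.1 := by
  classical
  set A : Set X := {w | dist y w ^ 2 + t < dist x w ^ 2} with hA
  have hAm : MeasurableSet A := measurableSet_lt (by fun_prop) (by fun_prop)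
  set T : X → X := fun w => if w ∈ A then y else x with hTdef
  have hT : Measurable T := Measurable.ite hAm measurable_const measurable_const
  have hm : Measurable (({y} : Set X).indicator fun _ => t) :=
    measurable_const.indicator (measurableSet_singleton y)
  have hint : Integrable (fun w => dist x (T w) ^ 2) μ.1 := by
    refine Integrable.mono' (integrable_const (dist x y ^ 2))
      (by fun_prop) (ae_of_all _ fun w => ?_)
    by_cases hw : w ∈ A <;> simp [hTdef, hw]
  have hdT : Integrable (fun w => dist w (T w) ^ 2) μ.1 := by
    refine Integrable.mono' ((μ.integrable_dist_sq x).add (μ.integrable_dist_sq y))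
      (by fun_prop) (ae_of_all _ fun w => ?_)
    by_cases hw : w ∈ A <;> simp [hTdef, hw, dist_comm w]
  have hmem : ∀ w, T w = x ∨ T w = y := fun w => by
    by_cases hw : w ∈ A <;> simp [hTdef, hw]
  refine ⟨μ.map T hT x hint, ?_, ?_⟩
  · change ∀ᵐ w ∂(μ.1.map T), w = x ∨ w = y
    refine (ae_map_iff hT.aemeasurable ?_).2 (ae_of_all _ hmem)
    exact (measurableSet_singleton x).union (measurableSet_singleton y)
  · have h1 := W2sq_le_of_map μ (μ.map T hT x hint) hT rfl
    have h2 : ∫ w, ({y} : Set X).indicator (fun _ => t) w ∂(μ.map T hT x hint).1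
        = ∫ w, ({y} : Set X).indicator (fun _ => t) (T w) ∂μ.1 :=
      integral_map hT.aemeasurable hm.aestronglyMeasurable
    have hi : Integrable (fun w => ({y} : Set X).indicator (fun _ => t) (T w)) μ.1 :=
      (integrable_const (μ := μ.1) t).indicator (hT (measurableSet_singleton y))
    rw [h2]
    refine (add_le_add_left h1 _).trans_eq ?_
    rw [← integral_add hdT hi]
    refine integral_congr_ae (ae_of_all _ fun w => ?_)
    by_cases hw : w ∈ A
    · have hw' : dist y w ^ 2 + t < dist x w ^ 2 := hw
      simp [hTdef, hw, dist_comm w, min_eq_right hw'.le]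
    · have hw' : dist x w ^ 2 ≤ dist y w ^ 2 + t := not_lt.1 hw
      simp [hTdef, hw, hxy, dist_comm w, min_eq_left hw']

variable {Ψ : W2Space X → W2Space X}

lemma map_sub_dist_sq_eq (hX : IsHadamard X) (hgc : GeodesicallyComplete X)
    (hneg : IsNegativelyCurved X) (hΨ : ∀ μ ν, W2sq (Ψ μ) (Ψ ν) = W2sq μ ν)
    (hd : ∀ x, Ψ (W2Space.dirac x) = W2Space.dirac x) {x y : X} (hxy : x ≠ y) (μ : W2Space X) :
    (Ψ μ).1.map (fun w => dist x w ^ 2 - dist y w ^ 2)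
      = μ.1.map (fun w => dist x w ^ 2 - dist y w ^ 2) := by
  obtain ⟨γ, hγ, h0, h1⟩ := exists_line_through hX hgc hxy
  have hfix : ∀ η : W2Space X, (∀ᵐ w ∂η.1, w = x ∨ w = y) → Ψ η = η := by
    intro η hη
    refine fixes_of_ae_mem_range hX hneg hΨ hd hγ (hη.mono fun w hw => ?_)
    rcases hw with rfl | rfl
    exacts [⟨_, h0⟩, ⟨_, h1⟩]
  have hmin : ∀ t : ℝ, ∫ w, min (dist x w ^ 2) (dist y w ^ 2 + t) ∂(Ψ μ).1
      = ∫ w, min (dist x w ^ 2) (dist y w ^ 2 + t) ∂μ.1 := by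
    intro t
    obtain ⟨η, hη, hle⟩ := exists_W2sq_add_le hxy t μ
    obtain ⟨η', hη', hle'⟩ := exists_W2sq_add_le hxy t (Ψ μ)
    have e := hΨ μ η
    have e' := hΨ μ η'
    rw [hfix η hη] at e
    rw [hfix η' hη'] at e'
    refine le_antisymm ?_ ?_
    · exact (integral_min_le_W2sq_add hxy t (Ψ μ) η hη).trans (by rwa [e])
    · exact (integral_min_le_W2sq_add hxy t μ η' hη').trans (by rwa [← e'])
  have hf : Measurable fun w => dist x w ^ 2 - dist y w ^ 2 := by fun_prop
  have := Measure.isProbabilityMeasure_map (μ := (Ψ μ).1) hf.aemeasurable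
  have := Measure.isProbabilityMeasure_map (μ := μ.1) hf.aemeasurable
  have hi : ∀ m : W2Space X, Integrable (fun s : ℝ => s)
      (m.1.map fun w => dist x w ^ 2 - dist y w ^ 2) := fun m =>
    (integrable_map_measure (by fun_prop) hf.aemeasurable).2
      ((m.integrable_dist_sq x).sub (m.integrable_dist_sq y))
  refine measure_eq_of_forall_integral_posPart (hi _) (hi _) fun c => ?_
  have hpos : ∀ m : W2Space X, ∫ s, max (s - c) 0 ∂(m.1.map fun w => dist x w ^ 2 - dist y w ^ 2)
      = ∫ w, dist x w ^ 2 ∂m.1 - ∫ w, min (dist x w ^ 2) (dist y w ^ 2 + c) ∂m.1 := by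
    intro m
    have hmin_int : Integrable (fun w => min (dist x w ^ 2) (dist y w ^ 2 + c)) m.1 :=
      (m.integrable_dist_sq x).inf ((m.integrable_dist_sq y).add (integrable_const c))
    rw [integral_map hf.aemeasurable (by fun_prop),
      ← integral_sub (m.integrable_dist_sq x) hmin_int]
    refine integral_congr_ae (ae_of_all _ fun w => ?_)
    simp only
    rcases le_total (dist x w ^ 2) (dist y w ^ 2 + c) with h | h
    · rw [min_eq_left h, max_eq_right (by linarith), sub_self]
    · rw [min_eq_right h, max_eq_left (by linarith)]
      ring
  rw [hpos, hpos, hmin, integral_dist_sq_eq_of_dirac hΨ hd]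

/-! ## Atoms -/

lemma measure_singleton_le (hX : IsHadamard X) (hgc : GeodesicallyComplete X)
    (hneg : IsNegativelyCurved X) (hΨ : ∀ μ ν, W2sq (Ψ μ) (Ψ ν) = W2sq μ ν)
    (hd : ∀ x, Ψ (W2Space.dirac x) = W2Space.dirac x) (μ : W2Space X) (x : X) :
    μ.1 {x} ≤ (Ψ μ).1 {x} := by
  by_cases hsub : ∃ y, x ≠ y
  · obtain ⟨y, hxy⟩ := hsub
    obtain ⟨γ, hγ, rfl, -⟩ := exists_line_through hX hgc hxy
    by_contra! hlt
    set H : ℕ → Set X := fun j => rightAngleSet (γ 0) (γ ((j:ℝ) + 1))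
    have hHm : ∀ j, MeasurableSet (H j) := fun j => measurableSet_rightAngleSet _ _
    have hxH : ∀ j, γ 0 ∈ H j := fun j => self_mem_rightAngleSet _ _
    have hne : ∀ j : ℕ, γ 0 ≠ γ ((j:ℝ) + 1) := fun j => by
      rw [← dist_pos, hγ, zero_sub, abs_neg]
      positivity
    have hH : ∀ j, (Ψ μ).1 (H j) = μ.1 (H j) := by
      intro j
      have hf : Measurable fun w => dist (γ 0) w ^ 2 - dist (γ ((j:ℝ) + 1)) w ^ 2 := by fun_prop
      have h := congrArg (fun m => m {-dist (γ 0) (γ ((j:ℝ) + 1)) ^ 2})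
        (map_sub_dist_sq_eq hX hgc hneg hΨ hd (hne j) μ)
      simp only [Measure.map_apply hf (measurableSet_singleton _)] at h
      exact h
    have hdisj : Pairwise (Function.onFun Disjoint fun j => H j \ {γ 0}) := by
      have key : ∀ i j : ℕ, i < j → Disjoint (H i \ {γ 0}) (H j \ {γ 0}) := by
        intro i j hij
        rw [Set.disjoint_left]
        rintro z ⟨hzi, hz0⟩ ⟨hzj, -⟩
        exact hz0 (hneg.eq_of_mem_rightAngleSet hγ (by positivity)
          (by exact_mod_cast Nat.succ_lt_succ hij) hzi hzj)
      intro i j hij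
      rcases hij.lt_or_gt with h | h
      exacts [key i j h, (key j i h).symm]
    have hfin := Measure.finite_const_le_meas_of_disjoint_iUnion (Ψ μ).1
      (tsub_pos_of_lt hlt) (fun j => (hHm j).diff (measurableSet_singleton (γ 0))) hdisj
      (measure_ne_top _ _)
    refine Set.infinite_univ (hfin.subset fun j _ => ?_)
    rw [Set.mem_ofPred_eq, measure_sdiff (Set.singleton_subset_iff.2 (hxH j))
      (measurableSet_singleton _).nullMeasurableSet (measure_ne_top _ _), hH]
    exact tsub_le_tsub_right (measure_mono (Set.singleton_subset_iff.2 (hxH j))) _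
  · push Not at hsub
    rw [show ({x} : Set X) = Set.univ from Set.eq_univ_of_forall fun y => (hsub y).symm]
    simp

lemma fixes_of_countable (hX : IsHadamard X) (hgc : GeodesicallyComplete X)
    (hneg : IsNegativelyCurved X) (hΨ : ∀ μ ν, W2sq (Ψ μ) (Ψ ν) = W2sq μ ν)
    (hd : ∀ x, Ψ (W2Space.dirac x) = W2Space.dirac x) {μ : W2Space X} {S : Set X}
    (hS : S.Countable) (hμ : ∀ᵐ w ∂μ.1, w ∈ S) : Ψ μ = μ := by
  have hle : μ.1 ≤ (Ψ μ).1 := by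
    refine Measure.le_iff.2 fun A hA => ?_
    have hc : (A ∩ S).Countable := hS.mono Set.inter_subset_right
    calc μ.1 A = μ.1 (A ∩ S) := by
          refine measure_congr ?_
          filter_upwards [hμ] with w hw
          exact propext ⟨fun h => ⟨h, hw⟩, fun h => h.1⟩
      _ = ∑' w : ↥(A ∩ S), μ.1 {(w : X)} := by
          rw [← measure_biUnion hc (fun a _ b _ hab => Set.disjoint_singleton.2 hab)
            (fun a _ => measurableSet_singleton a), Set.biUnion_of_singleton]
      _ ≤ ∑' w : ↥(A ∩ S), (Ψ μ).1 {(w : X)} :=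
          ENNReal.tsum_le_tsum fun w => measure_singleton_le hX hgc hneg hΨ hd μ w
      _ = (Ψ μ).1 (A ∩ S) := by
          rw [← measure_biUnion hc (fun a _ b _ hab => Set.disjoint_singleton.2 hab)
            (fun a _ => measurableSet_singleton a), Set.biUnion_of_singleton]
      _ ≤ (Ψ μ).1 A := measure_mono Set.inter_subset_left
  exact Subtype.ext (Measure.eq_of_le_of_measure_univ_eq hle (by simp)).symm

/-! ## Conclusion -/

lemma abs_integral_sub_le_of_W2sq_lt {μ ν : W2Space X} {ε : ℝ} (hε : 0 ≤ ε)
    (h : W2sq μ ν < ε ^ 2) {g : X → ℝ} {K : ℝ≥0} (hg : LipschitzWith K g)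
    (hg01 : ∀ y, g y ∈ Set.Icc (0:ℝ) 1) :
    |∫ y, g y ∂μ.1 - ∫ y, g y ∂ν.1| ≤ K * ε := by
  obtain ⟨π, hπ, hlt⟩ := exists_coupling_lt μ ν h
  refine (hπ.abs_integral_sub_le hπ.integrable_dist_sq hg hg01).trans ?_
  gcongr
  exact Real.sqrt_le_iff.2 ⟨hε, hlt.le⟩

/-- The measures with countable support are dense. -/
lemma exists_countable_W2sq_lt (μ : W2Space X) {ε : ℝ} (hε : 0 < ε) :
    ∃ (μ' : W2Space X) (S : Set X), S.Countable ∧ (∀ᵐ w ∂μ'.1, w ∈ S) ∧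
      W2sq μ μ' < ε ^ 2 := by
  obtain ⟨x₀, -⟩ := μ.2.2
  have : Nonempty X := ⟨x₀⟩
  obtain ⟨D, n, hn, hDn⟩ := exists_measurable_countable_approx X (half_pos hε)
  have hT : Measurable fun w => D (n w) := (measurable_of_countable D).comp hn
  have hint : Integrable (fun w => dist x₀ (D (n w)) ^ 2) μ.1 := by
    refine Integrable.mono' (((μ.integrable_dist_sq x₀).const_mul 2).add
      (integrable_const (2 * ε ^ 2))) (by fun_prop) (ae_of_all _ fun w => ?_)
    simp only [Real.norm_eq_abs, abs_sq, Pi.add_apply]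
    have h1 := dist_triangle x₀ w (D (n w))
    have h2 : dist x₀ (D (n w)) ≤ dist x₀ w + ε := by linarith [hDn w]
    have h3 := pow_le_pow_left₀ dist_nonneg h2 2
    nlinarith [sq_nonneg (dist x₀ w - ε)]
  refine ⟨μ.map _ hT x₀ hint, Set.range D, Set.countable_range D, ?_, ?_⟩
  · change ∀ᵐ w ∂(μ.1.map fun w => D (n w)), w ∈ Set.range D
    exact (ae_map_iff hT.aemeasurable (Set.countable_range D).measurableSet).2
      (ae_of_all _ fun w => Set.mem_range_self _)
  · refine (W2sq_le_of_map μ (μ.map _ hT x₀ hint) hT rfl).trans_lt ?_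
    have hle : ∀ w, dist w (D (n w)) ^ 2 ≤ (ε / 2) ^ 2 := fun w =>
      pow_le_pow_left₀ dist_nonneg (hDn w).le 2
    have h : ∫ w, dist w (D (n w)) ^ 2 ∂μ.1 ≤ ∫ _, (ε / 2) ^ 2 ∂μ.1 :=
      integral_mono_of_nonneg (ae_of_all _ fun _ => sq_nonneg _) (integrable_const _)
        (ae_of_all _ hle)
    rw [integral_const, probReal_univ, one_smul] at h
    nlinarith

/-- An isometry of the Wasserstein space fixing the Dirac masses is the identity. -/
lemma eq_self_of_fixes_dirac (hX : IsHadamard X) (hgc : GeodesicallyComplete X)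
    (hneg : IsNegativelyCurved X) (hΨ : ∀ μ ν, W2sq (Ψ μ) (Ψ ν) = W2sq μ ν)
    (hd : ∀ x, Ψ (W2Space.dirac x) = W2Space.dirac x) (μ : W2Space X) : Ψ μ = μ := by
  refine Subtype.ext (measure_eq_of_forall_lipschitz fun g K hg hg01 => ?_)
  rw [← sub_eq_zero, ← abs_eq_zero]
  refine le_antisymm (le_of_forall_pos_le_add fun δ hδ => ?_) (abs_nonneg _)
  set ε := δ / (2 * (K + 1)) with hεdef
  have hK : (0:ℝ) ≤ K := K.2
  have hε : 0 < ε := by positivity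
  obtain ⟨μ', S, hS, hμ', hlt⟩ := exists_countable_W2sq_lt μ hε
  have h1 := abs_integral_sub_le_of_W2sq_lt hε.le hlt hg hg01
  have hlt' : W2sq (Ψ μ) μ' < ε ^ 2 := by
    have e := hΨ μ μ'
    rw [fixes_of_countable hX hgc hneg hΨ hd hS hμ'] at e
    rwa [e]
  have h2 := abs_integral_sub_le_of_W2sq_lt hε.le hlt' hg hg01
  have h3 := abs_sub_le (∫ y, g y ∂(Ψ μ).1) (∫ y, g y ∂μ'.1) (∫ y, g y ∂μ.1)
  rw [abs_sub_comm (∫ y, g y ∂μ'.1)] at h3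
  have h4 : 2 * (K + 1) * ε = δ := by rw [hεdef]; field_simp
  nlinarith

end Rigidity

/-- **Statement 3.** Isometric rigidity: if `X` is a geodesically complete, negatively
curved Hadamard space which is a tree, or a Riemannian manifold, or, more generally, has a
dense set of points admitting a neighborhood isometric to an open subset of a Riemannian
manifold of dimension at least `2` (the Riemannian-manifold case is the special instance of
this where every point is such a point), then every isometry of `W₂(X)` is induced by an
isometry of `X`, i.e. `Isom X → Isom W₂(X)` is an isomorphism. -/
theorem wasserstein_isometric_rigidity
    (X : Type*) [MetricSpace X] [MeasurableSpace X] [BorelSpace X]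
    (hX : IsHadamard X) (hgc : GeodesicallyComplete X) (hneg : IsNegativelyCurved X)
    (hcase : IsRealTree X ∨ Dense {x : X | IsLocallyRiemannian X x}) :
    (∀ Φ : W2Space X ≃ W2Space X, (∀ μ ν : W2Space X, Wdist (Φ μ) (Φ ν) = Wdist μ ν) →
      ∃ φ : X ≃ᵢ X, ∀ μ : W2Space X, (Φ μ).1 = μ.1.map φ) ∧
    Function.Injective (fun φ : X ≃ᵢ X => fun μ : Measure X => μ.map φ) := by
  have := hX.separable
  have : SecondCountableTopology X := UniformSpace.secondCountable_of_separable X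
  constructor
  · intro Φ hΦ
    have hΦ' : ∀ μ ν, W2sq (Φ μ) (Φ ν) = W2sq μ ν := fun μ ν => W2sq_eq_iff.1 (hΦ μ ν)
    obtain ⟨φ, hφ⟩ := exists_isometryEquiv_dirac (exists_extension hX hgc) Φ hΦ'
    refine ⟨φ, fun μ => ?_⟩
    have h : pushforwardEquiv φ.symm (Φ μ) = μ := by
      refine eq_self_of_fixes_dirac (Ψ := fun μ => pushforwardEquiv φ.symm (Φ μ)) hX hgc hneg
        (fun μ ν => ?_) (fun x => ?_) μ
      · rw [W2sq_pushforwardEquiv, hΦ']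
      · rw [hφ, pushforwardEquiv_dirac, φ.symm_apply_apply]
    exact congrArg Subtype.val
      (((pushforwardEquiv φ).apply_symm_apply (Φ μ)).symm.trans (congrArg (pushforwardEquiv φ) h))
  · intro φ ψ h
    ext x
    have hx := congrFun h (Measure.dirac x)
    simp only [Measure.map_dirac' φ.continuous.measurable,
      Measure.map_dirac' ψ.continuous.measurable] at hx
    exact dirac_eq_dirac_iff.1 hx

end
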